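/- arXiv:2306.05306 — 3 statements merged into one kernel-verified Lean document; each statement's English description precedes it below -/
import Mathlib

section
/- There exist absolute constants c > 0 and C > 0 such that the following holds. Let X be a finite group and S ⊆ X a symmetric subset (closed under inverses) with d = |S| ≥ 1, and suppose the Cayley graph C(X,S) is non-bipartite. List the eigenvalues of the normalized adjacency matrix (1/d)A of C(X,S) with multiplicity as t₁ ≤ t₂ ≤ ⋯ ≤ t_N, where N = |X|. Then for every i ≤ N−1, the eigenvalue t_i lies in the interval [−1 + c·h_out²/d, 1 − C·h_out²/d], where h_out is the outer vertex isoperimetric constant of C(X,S). -/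
attribute [local instance] Classical.propDecidable

/-- The outer vertex boundary of a finite set `U`: vertices outside `U` with a neighbor in `U`. -/
noncomputable def outBd {V : Type*} [Fintype V] (Adj : V → V → Prop) (U : Finset V) : Finset V :=
  Finset.univ.filter fun y => y ∉ U ∧ ∃ x ∈ U, Adj x y

/-- The outer vertex isoperimetric constant: the minimum of `|∂_out U|/|U|` over nonempty sets
`U` with `|U| ≤ |V|/2`. -/
noncomputable def hOut {V : Type*} [Fintype V] (Adj : V → V → Prop) : ℝ :=
  sInf {r : ℝ | ∃ U : Finset V, U.Nonempty ∧ 2 * U.card ≤ Fintype.card V ∧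
    r = ((outBd Adj U).card : ℝ) / (U.card : ℝ)}

/-- A graph is bipartite if the vertex set can be partitioned into two parts such that every
edge joins the two parts. -/
def Bipartite {V : Type*} (Adj : V → V → Prop) : Prop :=
  ∃ P : V → Bool, ∀ x y, Adj x y → P x ≠ P y

section VertexIsoperimetry

open Finset MeasureTheory

variable {V : Type*} [Fintype V]

theorem hOut_nonneg (R : V → V → Prop) : 0 ≤ hOut R := by
  refine Real.sInf_nonneg ?_
  rintro r ⟨U, -, -, rfl⟩
  positivity

theorem hOut_mul_card_le (R : V → V → Prop) (U : Finset V)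
    (hU : 2 * #U ≤ Fintype.card V) : hOut R * #U ≤ #(outBd R U) := by
  rcases U.eq_empty_or_nonempty with rfl | hne
  · simp
  · have hpos : (0 : ℝ) < #U := by exact_mod_cast hne.card_pos
    rw [← le_div_iff₀ hpos]
    refine csInf_le ⟨0, ?_⟩ ⟨U, hne, hU, rfl⟩
    rintro r ⟨U, -, -, rfl⟩
    positivity

theorem hOut_le_two (R : V → V → Prop) (hV : 2 ≤ Fintype.card V) : hOut R ≤ 2 := by
  obtain ⟨U, -, hU⟩ := exists_subset_card_eq
    (show Fintype.card V / 2 ≤ #(univ : Finset V) by rw [card_univ]; omega)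
  have hle := hOut_mul_card_le R U (by omega)
  have hbd : #(outBd R U) ≤ #(Uᶜ) := card_le_card fun x hx => by
    simp only [outBd, mem_filter] at hx
    exact mem_compl.2 hx.2.1
  rw [card_compl] at hbd
  have hbd' : (#(outBd R U) : ℝ) ≤ 2 * #U := by
    exact_mod_cast (show #(outBd R U) ≤ 2 * #U by omega)
  have hpos : (0 : ℝ) < #U := by exact_mod_cast (show 0 < #U by omega)
  exact le_of_mul_le_mul_right (hle.trans hbd') hpos

/-- A set `Q` that no edge starting outside `B` enters or leaves has boundary inside `B`. -/
theorem hOut_mul_card_le_of_closed (R : V → V → Prop) (Q B : Finset V)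
    (hQ : 2 * #Q ≤ Fintype.card V)
    (hsymm : ∀ x y, R x y → R y x)
    (hB : ∀ x y, R x y → x ∉ B → (x ∈ Q ↔ y ∈ Q)) : hOut R * #Q ≤ #B := by
  refine (hOut_mul_card_le R Q hQ).trans ?_
  refine Nat.cast_le.2 (card_le_card fun y hy => ?_)
  simp only [outBd, mem_filter] at hy
  obtain ⟨-, hyQ, x, hxQ, hxy⟩ := hy
  by_contra hyB
  exact hyQ ((hB y x (hsymm x y hxy) hyB).2 hxQ)

theorem hOut_mul_card_le_or_compl (R : V → V → Prop) (Q B : Finset V)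
    (hsymm : ∀ x y, R x y → R y x)
    (hB : ∀ x y, R x y → x ∉ B → (x ∈ Q ↔ y ∈ Q)) :
    hOut R * #Q ≤ #B ∨ hOut R * #(Qᶜ) ≤ #B := by
  by_cases hQ : 2 * #Q ≤ Fintype.card V
  · exact .inl (hOut_mul_card_le_of_closed R Q B hQ hsymm hB)
  · refine .inr (hOut_mul_card_le_of_closed R Qᶜ B ?_ hsymm ?_)
    · rw [card_compl]; omega
    · intro x y hxy hx
      simp only [mem_compl, hB x y hxy hx]

/-- If the set of bad levels of `x` has length at most `2 * L x`, some level `t ≥ 0` has few bad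
points compared to the superlevel set of `g`. -/
theorem exists_level_card_lt (g L : V → ℝ) (hg : ∀ x, 0 ≤ g x) (hL : ∀ x, 0 ≤ L x)
    (bad : ℝ → V → Prop) [∀ t, DecidablePred (bad t)]
    (hbad : ∀ t x, 0 ≤ t → bad t x → |t - g x| ≤ L x)
    (ε : ℝ) (hsum : ∑ x, 2 * L x < ε * ∑ x, g x) :
    ∃ t, 0 ≤ t ∧ (#{x | bad t x} : ℝ) < ε * #{x | t < g x} := by
  by_contra! hcon
  have hpt : ∀ t, ε * ∑ x, (Set.Ico 0 (g x)).indicator (fun _ => (1 : ℝ)) t ≤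
      ∑ x, (Set.Icc (g x - L x) (g x + L x)).indicator (fun _ => (1 : ℝ)) t := by
    intro t
    have hR : 0 ≤ ∑ x, (Set.Icc (g x - L x) (g x + L x)).indicator (fun _ => (1 : ℝ)) t :=
      sum_nonneg fun x _ => Set.indicator_nonneg (fun _ _ => zero_le_one) t
    by_cases ht : 0 ≤ t
    · have hU : ∑ x, (Set.Ico 0 (g x)).indicator (fun _ => (1 : ℝ)) t = #{x | t < g x} := by
        simp [Set.indicator_apply, ht]
      rw [hU]
      refine (hcon t ht).trans ?_
      rw [← sum_boole]
      refine sum_le_sum fun x _ => ?_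
      by_cases hx : bad t x
      · have := abs_le.1 (hbad t x ht hx)
        rw [if_pos hx, Set.indicator_of_mem]
        constructor <;> linarith
      · rw [if_neg hx]
        exact Set.indicator_nonneg (fun _ _ => zero_le_one) t
    · have hU : ∑ x, (Set.Ico 0 (g x)).indicator (fun _ => (1 : ℝ)) t = 0 := by
        simp [ht]
      rw [hU, mul_zero]
      exact hR
  have hint1 : ∀ x, Integrable ((Set.Ico 0 (g x)).indicator (fun _ => (1 : ℝ))) volume := by
    intro x
    rw [integrable_indicator_iff measurableSet_Ico]
    exact integrableOn_const (by simp)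
  have hint2 : ∀ x, Integrable
      ((Set.Icc (g x - L x) (g x + L x)).indicator (fun _ => (1 : ℝ))) volume := by
    intro x
    rw [integrable_indicator_iff measurableSet_Icc]
    exact integrableOn_const (by simp)
  have hmono := integral_mono (μ := volume)
    ((integrable_finsetSum univ fun x _ => hint1 x).const_mul ε)
    (integrable_finsetSum univ fun x _ => hint2 x) hpt
  rw [integral_const_mul, integral_finsetSum _ fun x _ => hint1 x,
    integral_finsetSum _ fun x _ => hint2 x] at hmono
  have h1 : ∀ x, ∫ t, (Set.Ico 0 (g x)).indicator (fun _ => (1 : ℝ)) t = g x := by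
    intro x
    rw [integral_indicator measurableSet_Ico]
    simp [hg x]
  have h2 : ∀ x, ∫ t, (Set.Icc (g x - L x) (g x + L x)).indicator (fun _ => (1 : ℝ)) t
      = 2 * L x := by
    intro x
    rw [integral_indicator measurableSet_Icc]
    have := hL x
    simp only [integral_const, measureReal_restrict_apply_univ, smul_eq_mul, mul_one]
    rw [Real.volume_real_Icc_of_le (by linarith)]
    ring
  simp only [h1, h2] at hmono
  linarith

/-- The sign of `u` truncated to `0` on `[-t, t]`. -/
noncomputable def truncSign (t u : ℝ) : ℤ := if t < u then 1 else if u < -t then -1 else 0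

theorem truncSign_values (t u : ℝ) :
    truncSign t u = -1 ∨ truncSign t u = 0 ∨ truncSign t u = 1 := by
  unfold truncSign
  split_ifs <;> simp

theorem truncSign_ne_zero_iff {t u : ℝ} : truncSign t u ≠ 0 ↔ t < |u| := by
  unfold truncSign
  rw [lt_abs]
  split_ifs with h1 h2
  · simp [h1]
  · simp [lt_neg.1 h2]
  · simp only [ne_eq, not_true_eq_false, false_iff, not_or]
    exact ⟨h1, fun h => h2 (lt_neg.1 h)⟩

theorem truncSign_neg {t : ℝ} (ht : 0 ≤ t) (u : ℝ) : truncSign t (-u) = -truncSign t u := by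
  unfold truncSign
  split_ifs <;> first | rfl | (exfalso; linarith)

theorem abs_sub_abs_le_of_truncSign_ne {t u v : ℝ} (ht : 0 ≤ t)
    (h : truncSign t u ≠ truncSign t v) : |(t - |u|)| ≤ |u - v| := by
  unfold truncSign at h
  rw [abs_le]
  split_ifs at h <;>
    first
    | exact absurd rfl h
    | (rcases abs_cases u with ⟨h1, _⟩ | ⟨h1, _⟩ <;>
        rcases abs_cases (u - v) with ⟨h2, _⟩ | ⟨h2, _⟩ <;>
        rw [h1, h2] <;> constructor <;> linarith)

theorem abs_mul_abs_sub_le (a b m : ℝ) (h : |a - b| ≤ m) :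
    |(a * |a| - b * |b|)| ≤ m * (2 * |a| + m) := by
  have h1 : |(a * |a| - b * |b|)| ≤ |a - b| * (|a| + |b|) := by
    have : a * |a| - b * |b| = ((a - b) * (|a| + |b|) + (a + b) * (|a| - |b|)) / 2 := by ring
    have h3 : |a + b| * abs (|a| - |b|) ≤ (|a| + |b|) * |a - b| :=
      mul_le_mul (abs_add_le a b) (abs_abs_sub_abs_le a b) (abs_nonneg _) (by positivity)
    rw [this, abs_div, abs_two]
    have h4 := abs_add_le ((a - b) * (|a| + |b|)) ((a + b) * (|a| - |b|))
    rw [abs_mul, abs_mul, abs_of_nonneg (show 0 ≤ |a| + |b| by positivity)] at h4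
    linarith
  have h2 : |b| ≤ |a| + m := by
    have := abs_sub_abs_le_abs_sub b a
    rw [abs_sub_comm] at this
    linarith
  have : 0 ≤ |a - b| := abs_nonneg _
  exact h1.trans (mul_le_mul h (by linarith) (by positivity) (by linarith))

/-- A function of small signed energy yields a `{-1, 0, 1}`-valued function that is compatible
with all edges starting at most vertices, relative to the size of its support. -/
theorem exists_sign_function (R : V → V → Prop) (a : V → V → ℝ) (ha : ∀ x y, 0 ≤ a x y)
    (haR : ∀ x y, R x y → 1 ≤ a x y) (f : V → ℝ) (s : ℤ) (hs : s = 1 ∨ s = -1)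
    (μ ε : ℝ) (hε : 0 < ε) (hε2 : ε ≤ 2) (hμ : μ < ε ^ 2 / 48) (hf : 0 < ∑ x, f x ^ 2)
    (hE : ∑ x, ∑ y, a x y * (f x - s * f y) ^ 2 ≤ 2 * μ * ∑ x, f x ^ 2) :
    ∃ (χ : V → ℤ) (B : Finset V), (∀ x, χ x = -1 ∨ χ x = 0 ∨ χ x = 1) ∧
      (∀ x, χ x ≠ 0 → f x ≠ 0) ∧ (∀ x y, R x y → x ∉ B → χ x = s * χ y) ∧
      (#B : ℝ) < ε * #{x | χ x ≠ 0} := by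
  set m : V → ℝ := fun x => √(∑ y, a x y * (f x - s * f y) ^ 2) with hm
  have hterm : ∀ x y, 0 ≤ a x y * (f x - s * f y) ^ 2 := fun x y =>
    mul_nonneg (ha x y) (sq_nonneg _)
  have hm0 : ∀ x, 0 ≤ m x := fun x => Real.sqrt_nonneg _
  have hmsq : ∀ x, m x ^ 2 = ∑ y, a x y * (f x - s * f y) ^ 2 := fun x =>
    Real.sq_sqrt (sum_nonneg fun y _ => hterm x y)
  have hmle : ∀ x y, R x y → |f x - s * f y| ≤ m x := by
    intro x y hxy
    refine Real.abs_le_sqrt ?_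
    refine le_trans ?_ (single_le_sum (fun y _ => hterm x y) (mem_univ y))
    exact le_mul_of_one_le_left (sq_nonneg _) (haR x y hxy)
  have hsabs : |(s : ℝ)| = 1 := by rcases hs with rfl | rfl <;> simp
  have hsign : ∀ t, 0 ≤ t → ∀ u, s * truncSign t u = truncSign t (s * u) := by
    intro t ht u
    rcases hs with rfl | rfl
    · simp
    · simp [truncSign_neg ht]
  have habs : ∀ x, |(f x * |f x|)| = f x ^ 2 := fun x => by
    rw [abs_mul, abs_abs, ← sq, sq_abs]
  obtain ⟨t, ht, hlt⟩ := exists_level_card_lt (fun x => f x ^ 2)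
    (fun x => m x * (2 * |f x| + m x)) (fun x => sq_nonneg _)
    (fun x => by have := hm0 x; positivity)
    (fun t x => ∃ y, R x y ∧ truncSign t (f x * |f x|) ≠ s * truncSign t (f y * |f y|))
    (by
      rintro t x ht ⟨y, hxy, hne⟩
      rw [hsign t ht] at hne
      have h1 := abs_sub_abs_le_of_truncSign_ne ht hne
      have h2 := abs_mul_abs_sub_le _ _ _ (hmle x y hxy)
      rw [abs_mul (s : ℝ), hsabs, one_mul, mul_assoc] at h2
      rw [habs] at h1
      exact h1.trans h2) ε
    (by
      have hpt : ∀ x, 2 * (m x * (2 * |f x| + m x)) ≤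
          (8 / ε + 2) * m x ^ 2 + ε / 2 * f x ^ 2 := by
        intro x
        have h0 : 0 ≤ 8 / ε * (m x - ε / 4 * |f x|) ^ 2 := by positivity
        have h1 : 8 / ε * (m x - ε / 4 * |f x|) ^ 2
            = 8 / ε * m x ^ 2 - 4 * m x * |f x| + ε / 2 * |f x| ^ 2 := by
          field_simp
          ring
        rw [h1, sq_abs] at h0
        linarith
      refine (sum_le_sum fun x _ => hpt x).trans_lt ?_
      rw [sum_add_distrib, ← mul_sum, ← mul_sum]
      simp only [hmsq]
      have h1 : (8 / ε + 2) * ∑ x, ∑ y, a x y * (f x - s * f y) ^ 2 ≤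
          (8 / ε + 2) * (2 * μ * ∑ x, f x ^ 2) :=
        mul_le_mul_of_nonneg_left hE (by positivity)
      have h2 : (8 / ε + 2) * (2 * μ) < ε / 2 := by
        have h3 : (8 / ε + 2) * (2 * μ) < (8 / ε + 2) * (2 * (ε ^ 2 / 48)) := by gcongr
        have h4 : (8 / ε + 2) * (2 * (ε ^ 2 / 48)) = ε / 3 + ε * ε / 12 := by
          field_simp
          ring
        nlinarith
      have h5 := mul_lt_mul_of_pos_right h2 hf
      linarith)
  refine ⟨fun x => truncSign t (f x * |f x|), _, fun x => truncSign_values _ _, ?_, ?_,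
    by simpa only [truncSign_ne_zero_iff, habs] using hlt⟩
  · intro x hx hfx
    rw [truncSign_ne_zero_iff, hfx] at hx
    simp at hx
    linarith
  · intro x y hxy hx
    by_contra hne
    exact hx (by rw [mem_filter]; exact ⟨mem_univ x, y, hxy, hne⟩)

/-- Expansion of the signed energy of a function on a `d`-regular weighted graph. -/
theorem sum_sum_weight_mul_sq (a : V → V → ℝ) (d : ℝ) (hrow : ∀ x, ∑ y, a x y = d)
    (hcol : ∀ y, ∑ x, a x y = d) (f : V → ℝ) (s : ℝ) (hs : s ^ 2 = 1) :
    ∑ x, ∑ y, a x y * (f x - s * f y) ^ 2 =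
      2 * d * ∑ x, f x ^ 2 - 2 * s * ∑ x, f x * ∑ y, a x y * f y := by
  have h1 : ∑ x, ∑ y, a x y * f x ^ 2 = d * ∑ x, f x ^ 2 := by
    simp only [← sum_mul, hrow, mul_sum]
  have h2 : ∑ x, ∑ y, a x y * f y ^ 2 = d * ∑ x, f x ^ 2 := by
    rw [sum_comm]
    simp only [← sum_mul, hcol, mul_sum]
  have h3 : ∑ x, ∑ y, 2 * s * (f x * (a x y * f y)) =
      2 * s * ∑ x, f x * ∑ y, a x y * f y := by
    simp only [mul_sum]
  rw [← h3, two_mul, add_mul]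
  nth_rewrite 1 [← h1]
  rw [← h2, ← sum_add_distrib, ← sum_sub_distrib]
  refine sum_congr rfl fun x _ => ?_
  rw [← sum_add_distrib, ← sum_sub_distrib]
  refine sum_congr rfl fun y _ => ?_
  linear_combination (a x y * f y ^ 2) * hs

end VertexIsoperimetry

section Cayley

open Finset

theorem cayley_adj_symm {X : Type*} [Group X] {S : Finset X} (hS : ∀ s ∈ S, s⁻¹ ∈ S) (x y : X)
    (h : x * y⁻¹ ∈ S) : y * x⁻¹ ∈ S := by
  simpa using hS _ h

theorem cayley_weight_nonneg {X : Type*} [Group X] (S : Finset X) (x y : X) :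
    (0 : ℝ) ≤ if x * y⁻¹ ∈ S then 1 else 0 := by
  split_ifs <;> norm_num

variable {X : Type*} [Group X] [Fintype X]

theorem cayley_row_sum (S : Finset X) (x : X) :
    ∑ y, (if x * y⁻¹ ∈ S then (1 : ℝ) else 0) = #S := by
  rw [Fintype.sum_equiv ((Equiv.inv X).trans (Equiv.mulLeft x)) _
    (fun z : X => if z ∈ S then (1 : ℝ) else 0) fun y => by simp]
  simp

theorem cayley_col_sum (S : Finset X) (y : X) :
    ∑ x : X, (if x * y⁻¹ ∈ S then (1 : ℝ) else 0) = #S := by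
  refine (Fintype.sum_equiv (Equiv.mulRight y⁻¹) _
    (fun z : X => if z ∈ S then (1 : ℝ) else 0) fun _ => rfl).trans ?_
  simp

theorem cayley_energy (S : Finset X) (f : X → ℝ) (s : ℤ) (hs : s = 1 ∨ s = -1) :
    ∑ x, ∑ y, (if x * y⁻¹ ∈ S then (1 : ℝ) else 0) * (f x - s * f y) ^ 2 =
      2 * #S * ∑ x, f x ^ 2 -
        2 * s * ∑ x, f x * ∑ y, (if x * y⁻¹ ∈ S then (1 : ℝ) else 0) * f y := by
  exact sum_sum_weight_mul_sq _ _ (cayley_row_sum S) (cayley_col_sum S) f s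
    (by rcases hs with rfl | rfl <;> norm_num)

theorem sum_sq_pos {ι : Type*} [Fintype ι] {f : ι → ℝ} (hf : ∃ x, f x ≠ 0) :
    0 < ∑ x, f x ^ 2 := by
  obtain ⟨x, hx⟩ := hf
  exact sum_pos' (fun x _ => sq_nonneg _) ⟨x, mem_univ x, by positivity⟩

/-- Vertex Cheeger inequality for an eigenfunction whose positive part has small support. -/
theorem cayley_gap_of_support (S : Finset X) (hS : ∀ s ∈ S, s⁻¹ ∈ S)
    (hX : 2 ≤ Fintype.card X) (f : X → ℝ) (r : ℝ)
    (hf : ∀ x, ∑ y, (if x * y⁻¹ ∈ S then (1 : ℝ) else 0) * f y = r * f x)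
    (hpos : ∃ x, 0 < f x) (hsupp : 2 * #{x | 0 < f x} ≤ Fintype.card X) :
    hOut (fun x y : X => x * y⁻¹ ∈ S) ^ 2 / 48 ≤ #S - r := by
  set h := hOut (fun x y : X => x * y⁻¹ ∈ S) with hh
  by_contra! hlt
  set p : X → ℝ := fun x => max (f x) 0 with hp
  have hpsq : 0 < ∑ x, p x ^ 2 := by
    obtain ⟨x, hx⟩ := hpos
    exact sum_sq_pos ⟨x, by rw [hp]; simp only [max_eq_left hx.le]; exact hx.ne'⟩
  have hform : r * ∑ x, p x ^ 2 ≤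
      ∑ x, p x * ∑ y, (if x * y⁻¹ ∈ S then (1 : ℝ) else 0) * p y := by
    rw [mul_sum]
    refine sum_le_sum fun x _ => ?_
    rcases le_or_gt (f x) 0 with hx | hx
    · simp [hp, max_eq_right hx]
    · have h1 : p x = f x := max_eq_left hx.le
      have h2 : r * f x ≤ ∑ y, (if x * y⁻¹ ∈ S then (1 : ℝ) else 0) * p y := by
        rw [← hf x]
        refine sum_le_sum fun y _ => mul_le_mul_of_nonneg_left (le_max_left _ _)
          (cayley_weight_nonneg S x y)
      rw [h1]
      nlinarith
  have hE := cayley_energy S p 1 (.inl rfl)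
  have hE0 : 0 ≤ ∑ x, ∑ y, (if x * y⁻¹ ∈ S then (1 : ℝ) else 0) * (p x - (1 : ℤ) * p y) ^ 2 :=
    sum_nonneg fun x _ => sum_nonneg fun y _ =>
      mul_nonneg (cayley_weight_nonneg S x y) (sq_nonneg _)
  have hEle : ∑ x, ∑ y, (if x * y⁻¹ ∈ S then (1 : ℝ) else 0) * (p x - (1 : ℤ) * p y) ^ 2 ≤
      2 * (#S - r) * ∑ x, p x ^ 2 := by
    rw [hE]; push_cast; linarith
  have hr : 0 ≤ #S - r := by
    by_contra! hneg
    nlinarith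
  have h0 : 0 < h := by
    refine lt_of_le_of_ne (hOut_nonneg _) fun h0 => ?_
    rw [← h0] at hlt
    linarith
  obtain ⟨χ, B, -, hχ0, hB, hχ⟩ := exists_sign_function (fun x y : X => x * y⁻¹ ∈ S) _
    (cayley_weight_nonneg S) (fun x y hxy => (if_pos hxy).ge) p 1 (.inl rfl)
    (#S - r) h h0 (hOut_le_two _ hX) hlt hpsq hEle
  have hsub : #{x | χ x ≠ 0} ≤ #{x | 0 < f x} := card_le_card fun x hx => by
    simp only [mem_filter, mem_univ, true_and] at hx ⊢
    by_contra! hle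
    exact hχ0 x hx (max_eq_right hle)
  have := hOut_mul_card_le_of_closed (fun x y : X => x * y⁻¹ ∈ S) {x | χ x ≠ 0} B
    (by omega) (cayley_adj_symm hS) (by
      intro x y hxy hx
      simp only [mem_filter, mem_univ, true_and, hB x y hxy hx, one_mul])
  rw [← hh] at this
  linarith

theorem cayley_gap (S : Finset X) (hS : ∀ s ∈ S, s⁻¹ ∈ S)
    (hX : 2 ≤ Fintype.card X) (f : X → ℝ) (r : ℝ)
    (hf : ∀ x, ∑ y, (if x * y⁻¹ ∈ S then (1 : ℝ) else 0) * f y = r * f x)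
    (hne : ∃ x, f x ≠ 0) (hsum : ∑ x, f x = 0) :
    hOut (fun x y : X => x * y⁻¹ ∈ S) ^ 2 / 48 ≤ #S - r := by
  have hne' : ∃ x ∈ univ, f x ≠ 0 := by simpa using hne
  by_cases hc : 2 * #{x | 0 < f x} ≤ Fintype.card X
  · obtain ⟨x, -, hx⟩ := exists_pos_of_sum_zero_of_exists_nonzero f hsum hne'
    exact cayley_gap_of_support S hS hX f r hf ⟨x, hx⟩ hc
  · obtain ⟨x, -, hx⟩ := exists_pos_of_sum_zero_of_exists_nonzero (s := univ) (fun x => -f x)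
      (by simp [hsum]) (by simpa using hne)
    refine cayley_gap_of_support S hS hX (fun x => -f x) r ?_ ⟨x, hx⟩ ?_
    · intro x
      simp only [mul_neg, sum_neg_distrib, hf x]
    · have hdisj : Disjoint (univ.filter fun x => 0 < f x) (univ.filter fun x => 0 < -f x) :=
        disjoint_filter.2 fun x _ h1 h2 => by linarith
      have := card_le_univ ((univ.filter fun x => 0 < f x) ∪ (univ.filter fun x => 0 < -f x))
      rw [card_union_of_disjoint hdisj] at this
      omega

theorem card_filter_mul_right (Q : X → Prop) [DecidablePred Q] (g : X) :
    #{x | Q (x * g)} = #{x | Q x} :=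
  card_equiv (Equiv.mulRight g) fun x => by simp

/-- Fewer than `|V|` points in total are excluded, so some point satisfies all three predicates. -/
theorem exists_of_card_compl_lt {V : Type*} [Fintype V] (P Q R : V → Prop) [DecidablePred P]
    [DecidablePred Q] [DecidablePred R] (δ : ℝ)
    (hδ : 3 * δ < Fintype.card V) (hP : (#{x | ¬ P x} : ℝ) ≤ δ) (hQ : (#{x | ¬ Q x} : ℝ) ≤ δ)
    (hR : (#{x | ¬ R x} : ℝ) ≤ δ) : ∃ x, P x ∧ Q x ∧ R x := by
  by_contra! hcon
  have hcov : (univ : Finset V) ⊆ (univ.filter fun x => ¬ P x) ∪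
      ((univ.filter fun x => ¬ Q x) ∪ (univ.filter fun x => ¬ R x)) := by
    intro x _
    have := hcon x
    simp only [mem_union, mem_filter, mem_univ, true_and]
    tauto
  have h1 := card_le_card hcov
  have h2 := card_union_le (univ.filter fun x => ¬ P x)
    ((univ.filter fun x => ¬ Q x) ∪ (univ.filter fun x => ¬ R x))
  have h3 := card_union_le (univ.filter fun x => ¬ Q x) (univ.filter fun x => ¬ R x)
  rw [card_univ] at h1
  have h4 : (Fintype.card V : ℝ) ≤ #{x | ¬ P x} + (#{x | ¬ Q x} + #{x | ¬ R x}) := by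
    exact_mod_cast h1.trans (h2.trans (by omega))
  linarith

/-- A `{-1, 0, 1}`-valued function which is multiplicatively almost equivariant under right
translations and almost anti-invariant under left multiplication by `S` forces the Cayley graph
to be bipartite. -/
theorem cayley_bipartite_of_almost_character (S : Finset X) (χ : X → ℤ) (σ : X → ℤ) (δ : ℝ)
    (hχ : ∀ x, χ x = -1 ∨ χ x = 0 ∨ χ x = 1) (hσ : ∀ g, σ g = 1 ∨ σ g = -1)
    (hδ : 3 * δ < Fintype.card X)
    (hσχ : ∀ g, (#{x | ¬ χ x * χ (x * g) = σ g} : ℝ) ≤ δ)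
    (hSχ : ∀ s ∈ S, (#{x | ¬ χ (s * x) = -χ x} : ℝ) ≤ δ) :
    Bipartite (fun x y : X => x * y⁻¹ ∈ S) := by
  have hmul : ∀ g k, σ (g * k) = σ g * σ k := by
    intro g k
    have hQ : (#{x | ¬ χ (x * g) * χ (x * g * k) = σ k} : ℝ) ≤ δ := by
      rw [card_filter_mul_right (fun x => ¬ χ x * χ (x * k) = σ k) g]
      exact hσχ k
    obtain ⟨x, h1, h2, h3⟩ := exists_of_card_compl_lt (fun x => χ x * χ (x * g) = σ g)
      (fun x => χ (x * g) * χ (x * g * k) = σ k) (fun x => χ x * χ (x * (g * k)) = σ (g * k))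
      δ hδ (hσχ g) hQ (hσχ (g * k))
    have hsq : χ (x * g) * χ (x * g) = 1 := by
      rcases hχ (x * g) with h | h | h
      · simp [h]
      · rw [h, mul_zero] at h1
        rcases hσ g with h' | h' <;> rw [h'] at h1 <;> norm_num at h1
      · simp [h]
    rw [← h1, ← h2, ← h3, mul_assoc x g k]
    linear_combination (-χ x * χ (x * (g * k))) * hsq
  obtain ⟨a, ha⟩ : ∃ a, (#{g | ¬ χ a * χ (a * g) = σ g} : ℝ) ≤ δ := by
    have hdc : ∑ a, (#{g | ¬ χ a * χ (a * g) = σ g} : ℝ) ≤ ∑ _a : X, δ := by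
      have := sum_card_bipartiteAbove_eq_sum_card_bipartiteBelow (s := univ) (t := univ)
        (fun a g : X => ¬ χ a * χ (a * g) = σ g)
      simp only [bipartiteAbove, bipartiteBelow] at this
      have hc : ∑ a, (#{g | ¬ χ a * χ (a * g) = σ g} : ℝ) =
          ∑ g, (#{a | ¬ χ a * χ (a * g) = σ g} : ℝ) := by exact_mod_cast this
      rw [hc]
      exact sum_le_sum fun g _ => hσχ g
    obtain ⟨a, -, ha⟩ := exists_le_of_sum_le univ_nonempty hdc
    exact ⟨a, ha⟩
  have hσS : ∀ s ∈ S, σ s = -1 := by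
    intro s hs
    have hQ : #{g | ¬ χ a * χ (a * (a⁻¹ * s * a * g)) = σ (a⁻¹ * s * a * g)} =
        #{g | ¬ χ a * χ (a * g) = σ g} :=
      card_equiv (Equiv.mulLeft (a⁻¹ * s * a)) fun x => by simp [mul_assoc]
    have hR : #{g | ¬ χ (s * (a * g)) = -χ (a * g)} = #{x | ¬ χ (s * x) = -χ x} :=
      card_equiv (Equiv.mulLeft a) fun x => by simp
    obtain ⟨g, h1, h2, h3⟩ := exists_of_card_compl_lt (fun g => χ a * χ (a * g) = σ g)
      (fun g => χ a * χ (a * (a⁻¹ * s * a * g)) = σ (a⁻¹ * s * a * g))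
      (fun g => χ (s * (a * g)) = -χ (a * g)) δ hδ ha (by rw [hQ]; exact ha)
      (by rw [hR]; exact hSχ s hs)
    have hag : a * (a⁻¹ * s * a * g) = s * (a * g) := by group
    rw [hag, h3, mul_neg, h1, hmul, hmul, hmul] at h2
    have haa : σ a⁻¹ * σ a = 1 := by
      rw [← hmul, inv_mul_cancel]
      have := hmul 1 1
      rw [one_mul] at this
      rcases hσ 1 with h | h
      · exact h
      · rw [h] at this; norm_num at this
    have h4 : σ a⁻¹ * σ s * σ a * σ g = σ s * σ g := by
      linear_combination (σ s * σ g) * haa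
    rw [h4] at h2
    rcases hσ g with h | h <;> rw [h] at h2 <;> linarith
  refine ⟨fun x => decide (σ x = 1), fun x y hxy heq => ?_⟩
  have h1 := hσS _ hxy
  have h2 := hmul (x * y⁻¹) y
  rw [inv_mul_cancel_right, h1] at h2
  rw [decide_eq_decide] at heq
  rcases hσ y with hy | hy <;> rw [hy] at h2 heq <;> rw [h2] at heq <;> norm_num at heq

/-- An eigenfunction of a non-bipartite Cayley graph has eigenvalue far from `-|S|`. -/
theorem cayley_signed_gap (S : Finset X) (hS : ∀ s ∈ S, s⁻¹ ∈ S)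
    (hX : 2 ≤ Fintype.card X) (hbip : ¬ Bipartite (fun x y : X => x * y⁻¹ ∈ S))
    (f : X → ℝ) (r : ℝ)
    (hf : ∀ x, ∑ y, (if x * y⁻¹ ∈ S then (1 : ℝ) else 0) * f y = r * f x)
    (hne : ∃ x, f x ≠ 0) :
    hOut (fun x y : X => x * y⁻¹ ∈ S) ^ 2 / 480000 ≤ #S + r := by
  set h := hOut (fun x y : X => x * y⁻¹ ∈ S) with hh
  by_contra! hlt
  have hfsq := sum_sq_pos hne
  have hE := cayley_energy S f (-1) (.inr rfl)
  have hE0 : 0 ≤ ∑ x, ∑ y, (if x * y⁻¹ ∈ S then (1 : ℝ) else 0) * (f x - (-1 : ℤ) * f y) ^ 2 :=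
    sum_nonneg fun x _ => sum_nonneg fun y _ =>
      mul_nonneg (cayley_weight_nonneg S x y) (sq_nonneg _)
  have hform : ∑ x, f x * ∑ y, (if x * y⁻¹ ∈ S then (1 : ℝ) else 0) * f y =
      r * ∑ x, f x ^ 2 := by
    rw [mul_sum]
    exact sum_congr rfl fun x _ => by rw [hf x]; ring
  have hEeq : ∑ x, ∑ y, (if x * y⁻¹ ∈ S then (1 : ℝ) else 0) * (f x - (-1 : ℤ) * f y) ^ 2 =
      2 * (#S + r) * ∑ x, f x ^ 2 := by
    rw [hE, hform]; push_cast; ring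
  have hr : 0 ≤ #S + r := by
    by_contra! hneg
    nlinarith
  have h0 : 0 < h := by
    refine lt_of_le_of_ne (hOut_nonneg _) fun h0 => ?_
    rw [← h0] at hlt
    linarith
  have hle2 : h ≤ 2 := hOut_le_two _ hX
  obtain ⟨χ, B, hχ, -, hB, hχlt⟩ := exists_sign_function (fun x y : X => x * y⁻¹ ∈ S) _
    (cayley_weight_nonneg S) (fun x y hxy => (if_pos hxy).ge) f (-1) (.inr rfl)
    (#S + r) (h / 100) (by positivity) (by linarith) (by linarith) hfsq hEeq.le
  set n : ℝ := (Fintype.card X : ℝ) with hn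
  have hn0 : 0 < n := by rw [hn]; exact_mod_cast (show 0 < Fintype.card X by omega)
  have hgood : ∀ x y, x * y⁻¹ ∈ S → x ∉ B → χ y = -χ x := by
    intro x y hxy hx
    have := hB x y hxy hx
    linarith
  have hUn : (#{x | χ x ≠ 0} : ℝ) ≤ n := by
    rw [hn]; exact_mod_cast card_le_univ _
  have hBn : (#B : ℝ) < h * (n / 100) := by nlinarith
  have hW : (#{x | χ x = 0} : ℝ) ≤ n / 100 := by
    rcases hOut_mul_card_le_or_compl (fun x y : X => x * y⁻¹ ∈ S) {x | χ x ≠ 0} B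
      (cayley_adj_symm hS) (by
        intro x y hxy hx
        simp [hgood x y hxy hx]) with h1 | h1 <;> rw [← hh] at h1
    · have : (0 : ℝ) ≤ #{x | χ x ≠ 0} := by positivity
      nlinarith
    · have hc : (univ.filter fun x => χ x ≠ 0)ᶜ = univ.filter fun x => χ x = 0 := by ext; simp
      rw [hc] at h1
      exact le_of_mul_le_mul_left (h1.trans hBn.le) h0
  have hcorr : ∀ g, ∃ e : ℤ, (e = 1 ∨ e = -1) ∧
      (#{x | ¬ χ x * χ (x * g) = e} : ℝ) ≤ n / 25 := by
    intro g
    have hBg : (#(B ∪ univ.filter fun x => x * g ∈ B) : ℝ) ≤ h * (n / 50) := by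
      have h1 := card_union_le B (univ.filter fun x => x * g ∈ B)
      rw [card_filter_mul_right (fun x => x ∈ B) g, filter_univ_mem] at h1
      have h2 : (#(B ∪ univ.filter fun x => x * g ∈ B) : ℝ) ≤ #B + #B := by exact_mod_cast h1
      linarith
    rcases hOut_mul_card_le_or_compl (fun x y : X => x * y⁻¹ ∈ S)
      {x | χ x * χ (x * g) = 1} (B ∪ univ.filter fun x => x * g ∈ B) (cayley_adj_symm hS) (by
        intro x y hxy hx
        simp only [mem_union, mem_filter, mem_univ, true_and, not_or] at hx ⊢
        rw [hgood x y hxy hx.1, hgood (x * g) (y * g) (by simpa [mul_assoc] using hxy) hx.2]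
        simp) with h1 | h1 <;> rw [← hh] at h1
    · refine ⟨-1, .inr rfl, ?_⟩
      have h2 : (#{x | χ x * χ (x * g) = 1} : ℝ) ≤ n / 50 :=
        le_of_mul_le_mul_left (h1.trans hBg) h0
      have hsub : (univ.filter fun x => ¬ χ x * χ (x * g) = -1) ⊆
          (univ.filter fun x => χ x * χ (x * g) = 1) ∪
            ((univ.filter fun x => χ x = 0) ∪ (univ.filter fun x => χ (x * g) = 0)) := by
        intro x hx
        simp only [mem_union, mem_filter, mem_univ, true_and] at hx ⊢
        rcases hχ x with h | h | h <;> rcases hχ (x * g) with h' | h' | h' <;>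
          simp [h, h'] at hx ⊢
      have h3 := card_le_card hsub
      have h4 := card_union_le (univ.filter fun x => χ x * χ (x * g) = 1)
        ((univ.filter fun x => χ x = 0) ∪ (univ.filter fun x => χ (x * g) = 0))
      have h5 := card_union_le (univ.filter fun x => χ x = 0) (univ.filter fun x => χ (x * g) = 0)
      rw [card_filter_mul_right (fun x => χ x = 0) g] at h5
      have h6 : (#{x | ¬ χ x * χ (x * g) = -1} : ℝ) ≤
          #{x | χ x * χ (x * g) = 1} + (#{x | χ x = 0} + #{x | χ x = 0}) := by
        exact_mod_cast h3.trans (h4.trans (by omega))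
      linarith
    · refine ⟨1, .inl rfl, ?_⟩
      rw [compl_filter] at h1
      have h2 : (#{x | ¬ χ x * χ (x * g) = 1} : ℝ) ≤ n / 50 :=
        le_of_mul_le_mul_left (h1.trans hBg) h0
      linarith
  choose σ hσ hσχ using hcorr
  refine hbip (cayley_bipartite_of_almost_character S χ σ (n / 25) hχ hσ (by linarith) hσχ ?_)
  intro s hs
  have hsub : (univ.filter fun x => ¬ χ (s * x) = -χ x) ⊆ B := by
    intro x hx
    simp only [mem_filter, mem_univ, true_and] at hx
    by_contra hxB
    exact hx (hgood x (s * x) (by simpa using hS s hs) hxB)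
  have : (#{x | ¬ χ (s * x) = -χ x} : ℝ) ≤ #B := by exact_mod_cast card_le_card hsub
  nlinarith

end Cayley

/-- There are absolute constants `c, C > 0` such that for every non-bipartite finite Cayley
graph `C(X,S)` (with `S` symmetric, `d = |S| ≥ 1`), all eigenvalues of the normalized adjacency
matrix `(1/d)A`, listed in increasing order with multiplicity as `t₁ ≤ ⋯ ≤ t_N`, except possibly
the largest one, lie in `[-1 + c h_out²/d, 1 - C h_out²/d]`. -/
theorem cayley_eigenvalue_interval :
    ∃ c > (0 : ℝ), ∃ C > (0 : ℝ),
      ∀ (X : Type) [Group X] [Fintype X] (S : Finset X),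
        (∀ s ∈ S, s⁻¹ ∈ S) →
        1 ≤ S.card →
        ¬ Bipartite (fun x y : X => x * y⁻¹ ∈ S) →
        ∀ (hM : Matrix.IsHermitian
          ((S.card : ℝ)⁻¹ •
            Matrix.of (fun x y : X => if x * y⁻¹ ∈ S then (1 : ℝ) else 0)))
          (t : Fin (Fintype.card X) → ℝ),
        Monotone t →
        (∃ e : X ≃ Fin (Fintype.card X), ∀ x : X, t (e x) = hM.eigenvalues x) →
        ∀ i : Fin (Fintype.card X), (i : ℕ) < Fintype.card X - 1 →
          t i ∈ Set.Icc
            (-1 + c * hOut (fun x y : X => x * y⁻¹ ∈ S) ^ 2 / (S.card : ℝ))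
            (1 - C * hOut (fun x y : X => x * y⁻¹ ∈ S) ^ 2 / (S.card : ℝ)) := by
  refine ⟨1 / 480000, by norm_num, 1 / 48, by norm_num, ?_⟩
  intro X _ _ S hS hd hbip hM t ht ⟨e, he⟩ i hi
  have hX : 2 ≤ Fintype.card X := by omega
  have hd0 : (0 : ℝ) < S.card := by exact_mod_cast hd
  set h := hOut (fun x y : X => x * y⁻¹ ∈ S) with hh
  have heig : ∀ j : X, ∀ x, ∑ y, (if x * y⁻¹ ∈ S then (1 : ℝ) else 0) *
      hM.eigenvectorBasis j y = S.card * hM.eigenvalues j * hM.eigenvectorBasis j x := by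
    intro j x
    have h1 := congrFun (hM.mulVec_eigenvectorBasis j) x
    simp only [Matrix.mulVec, dotProduct, Matrix.smul_apply, Matrix.of_apply, Pi.smul_apply,
      smul_eq_mul, mul_assoc, ← Finset.mul_sum] at h1
    rw [mul_assoc, ← h1, mul_inv_cancel_left₀ hd0.ne']
  have hnz : ∀ j : X, ∃ x, hM.eigenvectorBasis j x ≠ 0 := by
    intro j
    by_contra! hz
    exact hM.eigenvectorBasis.orthonormal.ne_zero j (by ext x; exact hz x)
  have hsum : ∀ j : X, hM.eigenvalues j ≠ 1 → ∑ x, hM.eigenvectorBasis j x = 0 := by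
    intro j hj
    have h1 : ∑ x, ∑ y, (if x * y⁻¹ ∈ S then (1 : ℝ) else 0) * hM.eigenvectorBasis j y =
        S.card * ∑ y, hM.eigenvectorBasis j y := by
      rw [Finset.sum_comm]
      simp only [← Finset.sum_mul, cayley_col_sum, Finset.mul_sum]
    simp only [heig, ← Finset.mul_sum] at h1
    rw [mul_assoc] at h1
    have h2 := mul_left_cancel₀ hd0.ne' h1
    by_contra hne
    exact hj (mul_right_cancel₀ hne (h2.trans (one_mul _).symm))
  have hupper : ∀ r : ℝ, h ^ 2 / 48 ≤ S.card - S.card * r →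
      r ≤ 1 - 1 / 48 * h ^ 2 / S.card := by
    intro r hr
    rw [le_sub_iff_add_le, ← le_sub_iff_add_le', div_le_iff₀ hd0]
    linarith
  have hval : ∀ k, t k = hM.eigenvalues (e.symm k) := fun k => by rw [← he, e.apply_symm_apply]
  constructor
  · have h1 := cayley_signed_gap S hS hX hbip _ _ (heig (e.symm i)) (hnz _)
    rw [← hh, ← hval] at h1
    rw [neg_add_le_iff_le_add, div_le_iff₀ hd0]
    linarith
  · set l : Fin (Fintype.card X) := ⟨Fintype.card X - 1, by omega⟩ with hl
    have hil : i ≠ l := fun h => by rw [h] at hi; simp [hl] at hi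
    have hle : t i ≤ t l := ht (Fin.mk_le_mk.2 (by omega))
    have hgap : ∀ k, t k ≠ 1 → t k ≤ 1 - 1 / 48 * h ^ 2 / S.card := by
      intro k hk
      rw [hval] at hk ⊢
      exact hupper _ (cayley_gap S hS hX _ _ (heig _) (hnz _) (hsum _ hk))
    by_cases hi1 : t i = 1
    · by_cases hl1 : t l = 1
      · set u := hM.eigenvectorBasis (e.symm i) with hu
        set v := hM.eigenvectorBasis (e.symm l) with hv
        have hAu := heig (e.symm i)
        have hAv := heig (e.symm l)
        rw [← hval, hi1, ← hu] at hAu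
        rw [← hval, hl1, ← hv] at hAv
        rw [hi1]
        refine hupper 1 ?_
        by_cases hv0 : ∑ x, v x = 0
        · exact cayley_gap S hS hX _ _ hAv (hnz _) hv0
        · refine cayley_gap S hS hX (fun x => (∑ z, v z) * u x - (∑ z, u z) * v x) _ ?_ ?_ ?_
          · intro x
            simp only [mul_sub, Finset.sum_sub_distrib, mul_left_comm _ (∑ z, v z),
              mul_left_comm _ (∑ z, u z), ← Finset.mul_sum, hAu, hAv]
          · by_contra! hz
            have hlin : (∑ z, v z) • u = (∑ z, u z) • v := by
              ext x
              simpa [sub_eq_zero] using hz x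
            have horth : inner ℝ u v = 0 :=
              hM.eigenvectorBasis.orthonormal.2 fun h => hil (e.symm.injective h)
            have huu : inner ℝ u u = 1 := by
              rw [real_inner_self_eq_norm_sq, hM.eigenvectorBasis.orthonormal.1, one_pow]
            have h1 := congrArg (inner ℝ u) hlin
            rw [inner_smul_right, inner_smul_right, horth, huu] at h1
            simp at h1
            exact hv0 h1
          · simp only [Finset.sum_sub_distrib, ← Finset.mul_sum]
            ring
      · exact hle.trans (hgap l hl1)
    · exact hgap i hi1
end

section
/- Let (G,σ) be a d-regular finite signed graph with vertex measure π ≡ 1 (the counting measure). Then 2d·λ₁^σ ≥ λ_∞^σ ≥ (√(1 + h_out^σ) − 1)². -/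
attribute [local instance] Classical.propDecidable

/-- The Poincaré-type constant `λ_∞^σ` of a signed graph with vertex measure `π`: the largest
`λ` with `λ ∑ f(x)² π(x) ≤ ∑ sup_{y∼x} |f(x) − σ_{xy} f(y)|² π(x)` for all `f`. -/
noncomputable def lamInf {V : Type*} [Fintype V] (Adj : V → V → Prop) (σ : V → V → ℝ)
    (π : V → ℝ) : ℝ :=
  sSup {lam : ℝ | ∀ f : V → ℝ,
    lam * ∑ x : V, f x ^ 2 * π x ≤
      ∑ x : V, (⨆ y ∈ {y : V | Adj x y}, |f x - σ x y * f y| ^ 2) * π x}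

/-- The `∞`-frustration index `ι_∞^{σ,π}(U)` of a subset `U` of a signed graph. -/
noncomputable def iotaInf {V : Type*} [Fintype V] (Adj : V → V → Prop) (σ : V → V → ℝ)
    (π : V → ℝ) (U : Finset V) : ℝ :=
  sInf {r : ℝ | ∃ τ : V → ℝ, (∀ x : V, τ x = 1 ∨ τ x = -1) ∧
    r = (1 / 2) * ∑ x ∈ U,
      (⨆ y ∈ {y : V | y ∈ U ∧ Adj x y}, |τ x - σ x y * τ y|) * π x}

/-- The signed outer vertex isoperimetric constant `h_out^σ`. -/
noncomputable def hOutSigned {V : Type*} [Fintype V] (Adj : V → V → Prop) (σ : V → V → ℝ)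
    (π : V → ℝ) : ℝ :=
  sInf {r : ℝ | ∃ U : Finset V, U.Nonempty ∧
    r = (2 * iotaInf Adj σ π U + ∑ y ∈ outBd Adj U, π y) / ∑ x ∈ U, π x}

/-- The normalized signed Laplacian of a `d`-regular signed graph, as a matrix. -/
noncomputable def signedLap {V : Type*} [Fintype V] (Adj : V → V → Prop) (σ : V → V → ℝ)
    (d : ℕ) : Matrix V V ℝ :=
  Matrix.of fun x y =>
    (if x = y then (1 : ℝ) else 0) - (if Adj x y then σ x y / (d : ℝ) else 0)

/-- The smallest eigenvalue `λ₁^σ` of the normalized signed Laplacian. -/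
noncomputable def lam1 {V : Type*} [Fintype V] (Adj : V → V → Prop) (σ : V → V → ℝ)
    (d : ℕ) : ℝ :=
  sInf {r : ℝ | ∃ f : V → ℝ, f ≠ 0 ∧ (signedLap Adj σ d).mulVec f = r • f}

open MeasureTheory in
/-- The layer cake principle for finite linear combinations of indicators of `[0, a i)`. -/
lemma sum_mul_nonneg_of_layers {ι : Type*} [Fintype ι] (c a : ι → ℝ) (ha : ∀ i, 0 ≤ a i)
    (h : ∀ t : ℝ, 0 ≤ t → 0 ≤ ∑ i, c i * (if t < a i then 1 else 0)) :
    0 ≤ ∑ i, c i * a i := by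
  have hindint : ∀ i, Integrable ((Set.Ico 0 (a i)).indicator (1 : ℝ → ℝ)) := fun i =>
    (integrable_indicator_iff measurableSet_Ico).2
      (integrableOn_const (μ := volume) (s := Set.Ico 0 (a i)) (C := (1 : ℝ))
        (by simp [Real.volume_Ico]))
  have key : ∫ t : ℝ, ∑ i, c i * (Set.Ico 0 (a i)).indicator (1 : ℝ → ℝ) t
      = ∑ i, c i * a i := by
    rw [integral_finsetSum _ fun i _ => (hindint i).const_mul (c i)]
    refine Finset.sum_congr rfl fun i _ => ?_
    rw [integral_const_mul, integral_indicator_one measurableSet_Ico,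
      Real.volume_real_Ico_of_le (ha i), sub_zero]
  rw [← key]
  refine integral_nonneg fun t => ?_
  rcases le_or_gt 0 t with ht | ht
  · simpa [Set.indicator_apply, Set.mem_Ico, ht] using h t ht
  · simp [Set.mem_Ico, not_le.2 ht]

lemma le_biSup_of_mem {V : Type*} [Finite V] (g : V → ℝ) (S : Set V) {y : V} (hy : y ∈ S) :
    g y ≤ ⨆ z ∈ S, g z := by
  refine le_trans ?_ (le_ciSup (Set.finite_range fun z => ⨆ _ : z ∈ S, g z).bddAbove y)
  simp [hy]

lemma biSup_le_of_nonneg {V : Type*} (g : V → ℝ) (S : Set V) {c : ℝ} (hc : 0 ≤ c)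
    (h : ∀ y ∈ S, g y ≤ c) : ⨆ z ∈ S, g z ≤ c :=
  Real.iSup_le (fun y => Real.iSup_le (fun hy => h y hy) hc) hc

lemma biSup_nonneg {V : Type*} (g : V → ℝ) (S : Set V) (h : ∀ y, 0 ≤ g y) :
    0 ≤ ⨆ z ∈ S, g z :=
  Real.iSup_nonneg fun y => Real.iSup_nonneg fun _ => h y

section SignedGraph

variable {V : Type*} [Fintype V] (Adj : V → V → Prop) (σ : V → V → ℝ)

lemma iotaInf_nonneg (U : Finset V) : 0 ≤ iotaInf Adj σ (fun _ => 1) U := by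
  refine Real.sInf_nonneg ?_
  rintro r ⟨τ, -, rfl⟩
  refine mul_nonneg (by norm_num) (Finset.sum_nonneg fun x _ => ?_)
  rw [mul_one]
  exact biSup_nonneg _ _ fun y => abs_nonneg _

lemma two_mul_iotaInf_le (U : Finset V) (τ : V → ℝ) (hτ : ∀ x, τ x = 1 ∨ τ x = -1) :
    2 * iotaInf Adj σ (fun _ => 1) U ≤
      ∑ x ∈ U, ⨆ y ∈ {y : V | y ∈ U ∧ Adj x y}, |τ x - σ x y * τ y| := by
  have : iotaInf Adj σ (fun _ => 1) U ≤ (1 / 2) * ∑ x ∈ U,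
      (⨆ y ∈ {y : V | y ∈ U ∧ Adj x y}, |τ x - σ x y * τ y|) * 1 := by
    refine csInf_le ⟨0, ?_⟩ ⟨τ, hτ, rfl⟩
    rintro r ⟨τ, -, rfl⟩
    refine mul_nonneg (by norm_num) (Finset.sum_nonneg fun x _ => ?_)
    rw [mul_one]
    exact biSup_nonneg _ _ fun y => abs_nonneg _
  simp only [mul_one] at this
  linarith

lemma hOutSigned_nonneg : 0 ≤ hOutSigned Adj σ (fun _ => 1) := by
  refine Real.sInf_nonneg ?_
  rintro r ⟨U, -, rfl⟩
  have := iotaInf_nonneg Adj σ U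
  positivity

lemma hOutSigned_mul_card_le (U : Finset V) :
    hOutSigned Adj σ (fun _ => 1) * (U.card : ℝ) ≤
      2 * iotaInf Adj σ (fun _ => 1) U + ((outBd Adj U).card : ℝ) := by
  rcases U.eq_empty_or_nonempty with rfl | hU
  · have := iotaInf_nonneg Adj σ (∅ : Finset V)
    simp only [Finset.card_empty, Nat.cast_zero, mul_zero]
    positivity
  · have hc : (0 : ℝ) < U.card := by exact_mod_cast hU.card_pos
    rw [← le_div_iff₀ hc]
    refine csInf_le ⟨0, ?_⟩ ⟨U, hU, by simp⟩
    rintro r ⟨U, -, rfl⟩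
    have := iotaInf_nonneg Adj σ U
    positivity

lemma abs_sub_mul_le_two {s a b : ℝ} (hs : s = 1 ∨ s = -1) (ha : a = 1 ∨ a = -1)
    (hb : b = 1 ∨ b = -1) : |a - s * b| ≤ 2 := by
  rcases hs with rfl | rfl <;> rcases ha with rfl | rfl <;> rcases hb with rfl | rfl <;>
    norm_num

lemma hOutSigned_le_two (hσsign : ∀ x y : V, Adj x y → σ x y = 1 ∨ σ x y = -1) :
    hOutSigned Adj σ (fun _ => 1) ≤ 2 := by
  rcases isEmpty_or_nonempty V with hV | hV
  · have : {r : ℝ | ∃ U : Finset V, U.Nonempty ∧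
        r = (2 * iotaInf Adj σ (fun _ => 1) U + ∑ y ∈ outBd Adj U, (1 : ℝ)) /
          ∑ x ∈ U, (1 : ℝ)} = ∅ := by
      ext r
      simp [Finset.eq_empty_of_isEmpty]
    rw [hOutSigned, this, Real.sInf_empty]
    norm_num
  · have h1 := hOutSigned_mul_card_le Adj σ Finset.univ
    have h2 := two_mul_iotaInf_le Adj σ Finset.univ (fun _ => 1) fun _ => Or.inl rfl
    have h3 : ∑ x ∈ (Finset.univ : Finset V),
        (⨆ y ∈ {y : V | y ∈ (Finset.univ : Finset V) ∧ Adj x y}, |(1 : ℝ) - σ x y * 1|)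
        ≤ ∑ x ∈ (Finset.univ : Finset V), (2 : ℝ) :=
      Finset.sum_le_sum fun x _ => biSup_le_of_nonneg _ _ (by norm_num) fun y hy =>
        abs_sub_mul_le_two (hσsign x y hy.2) (Or.inl rfl) (Or.inl rfl)
    have h4 : outBd Adj (Finset.univ : Finset V) = ∅ := by simp [outBd]
    have hc : (0 : ℝ) < (Finset.univ : Finset V).card := by
      exact_mod_cast Finset.univ_nonempty.card_pos
    rw [h4] at h1
    simp only [Finset.sum_const, nsmul_eq_mul, Finset.card_empty, Nat.cast_zero] at h1 h3
    nlinarith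

/-- Layer cake bound for `h_out` over the superlevel sets of `f ^ 2`: here `m` dominates the
values of `f ^ 2` on closed neighborhoods, and `q` dominates `min (f x ^ 2) (f y ^ 2)` over the
edges `x ∼ y` that are frustrated by the signs `τ`. -/
lemma hOutSigned_mul_sum_sq_le (hsymm : ∀ x y : V, Adj x y → Adj y x)
    (hσsign : ∀ x y : V, Adj x y → σ x y = 1 ∨ σ x y = -1)
    (f τ m q : V → ℝ) (hτ : ∀ x, τ x = 1 ∨ τ x = -1)
    (hm : ∀ x, f x ^ 2 ≤ m x) (hm' : ∀ x y, Adj x y → f y ^ 2 ≤ m x)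
    (hq : ∀ x, 0 ≤ q x)
    (hq' : ∀ x y, Adj x y → τ x - σ x y * τ y ≠ 0 → min (f x ^ 2) (f y ^ 2) ≤ q x) :
    hOutSigned Adj σ (fun _ => 1) * ∑ x, f x ^ 2 ≤ ∑ x, (m x - f x ^ 2 + 2 * q x) := by
  set h := hOutSigned Adj σ (fun _ => 1) with hh
  have key := sum_mul_nonneg_of_layers (ι := V ⊕ (V ⊕ V))
    (Sum.elim (fun _ => -(h + 1)) (Sum.elim (fun _ => 1) (fun _ => 2)))
    (Sum.elim (fun x => f x ^ 2) (Sum.elim m q))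
    (by
      rintro (x | x | x)
      · exact sq_nonneg _
      · exact (sq_nonneg _).trans (hm x)
      · exact hq x)
    (by
      intro t ht
      simp only [Fintype.sum_sum_type, Sum.elim_inl, Sum.elim_inr, ← Finset.mul_sum]
      set U : Finset V := Finset.univ.filter fun x => t < f x ^ 2 with hU
      have h1 := hOutSigned_mul_card_le Adj σ U
      have h2 := two_mul_iotaInf_le Adj σ U τ hτ
      have h3 : (∑ x ∈ U, ⨆ y ∈ {y : V | y ∈ U ∧ Adj x y}, |τ x - σ x y * τ y|)
          ≤ 2 * ∑ x, (if t < q x then (1 : ℝ) else 0) := by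
        rw [Finset.mul_sum]
        refine (Finset.sum_le_sum fun x hx => ?_).trans
          (Finset.sum_le_univ_sum_of_nonneg (s := U) fun x => ?_)
        · refine biSup_le_of_nonneg _ _ (by split_ifs <;> norm_num) fun y hy => ?_
          by_cases hb : τ x - σ x y * τ y = 0
          · rw [hb, abs_zero]
            split_ifs <;> norm_num
          · have hty : t < f y ^ 2 := by simpa [hU] using hy.1
            have htx : t < f x ^ 2 := by simpa [hU] using hx
            rw [if_pos ((lt_min htx hty).trans_le (hq' x y hy.2 hb)), mul_one]
            exact abs_sub_mul_le_two (hσsign x y hy.2) (hτ x) (hτ y)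
        · split_ifs <;> norm_num
      have h4 : ((outBd Adj U).card : ℝ) + U.card ≤ ∑ x, (if t < m x then (1 : ℝ) else 0) := by
        have hd : Disjoint (outBd Adj U) U := by
          rw [Finset.disjoint_left]
          intro y hy
          exact (Finset.mem_filter.1 hy).2.1
        rw [Finset.sum_boole, ← Nat.cast_add, ← Finset.card_union_of_disjoint hd]
        refine Nat.cast_le.2 (Finset.card_le_card fun y hy => ?_)
        simp only [Finset.mem_filter, Finset.mem_univ, true_and]
        rcases Finset.mem_union.1 hy with hy | hy
        · obtain ⟨x, hx, hxy⟩ := (Finset.mem_filter.1 hy).2.2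
          have htx : t < f x ^ 2 := by simpa [hU] using hx
          exact htx.trans_le (hm' y x (hsymm x y hxy))
        · have hty : t < f y ^ 2 := by simpa [hU] using hy
          exact hty.trans_le (hm y)
      have h5 : ∑ x, (if t < f x ^ 2 then (1 : ℝ) else 0) = U.card := by
        rw [Finset.sum_boole]
      have h6 : 0 ≤ -(h + 1) * ∑ x, (if t < f x ^ 2 then (1 : ℝ) else 0) +
          (1 * ∑ x, (if t < m x then (1 : ℝ) else 0) +
            2 * ∑ x, (if t < q x then (1 : ℝ) else 0)) := by
        rw [h5]
        linarith
      exact h6)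
  simp only [Fintype.sum_sum_type, Sum.elim_inl, Sum.elim_inr, ← Finset.mul_sum] at key
  rw [Finset.sum_add_distrib, Finset.sum_sub_distrib, ← Finset.mul_sum]
  linarith

/-- The pointwise estimate at a vertex incident to a frustrated edge: `a = |f x|`, and `b` bounds
the values of `|f|` across frustrated edges. -/
lemma two_mul_min_sq_le {R a b : ℝ} (hR : 0 < R) (hR' : R ≤ 3 / 4) (ha : 0 ≤ a) (hb : 0 ≤ b) :
    R * (2 * min (a ^ 2) (b ^ 2)) ≤ (a + b - R * a) ^ 2 := by
  rcases le_total b a with hab | hab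
  · have h1 : min (a ^ 2) (b ^ 2) ≤ b ^ 2 := min_le_right _ _
    nlinarith [mul_nonneg hb (sub_nonneg.2 hab), mul_nonneg ha hb, sq_nonneg b,
      mul_nonneg ha (sub_nonneg.2 hab),
      mul_le_mul_of_nonneg_left h1 hR.le, mul_le_mul_of_nonneg_right hR' (sq_nonneg b),
      pow_le_pow_left₀ (by nlinarith : 0 ≤ b + (1 / 4) * b)
        (by nlinarith : b + (1 / 4) * b ≤ a + b - R * a) 2]
  · have h1 : min (a ^ 2) (b ^ 2) ≤ a ^ 2 := min_le_left _ _
    nlinarith [mul_le_mul_of_nonneg_left h1 hR.le, mul_le_mul_of_nonneg_right hR' (sq_nonneg a),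
      pow_le_pow_left₀ (by nlinarith : 0 ≤ a + (1 / 4) * a)
        (by nlinarith : a + (1 / 4) * a ≤ a + b - R * a) 2, sq_nonneg a]

lemma sq_mul_sum_sq_le (hsymm : ∀ x y : V, Adj x y → Adj y x)
    (hσsign : ∀ x y : V, Adj x y → σ x y = 1 ∨ σ x y = -1) (f : V → ℝ) :
    (Real.sqrt (1 + hOutSigned Adj σ (fun _ => 1)) - 1) ^ 2 * ∑ x, f x ^ 2 ≤
      ∑ x, ⨆ y ∈ {y : V | Adj x y}, |f x - σ x y * f y| ^ 2 := by
  have hh0 := hOutSigned_nonneg Adj σ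
  have hh2 := hOutSigned_le_two Adj σ hσsign
  set h := hOutSigned Adj σ (fun _ => 1) with hh
  set R := Real.sqrt (1 + h) - 1 with hRdef
  have hRh : h = R ^ 2 + 2 * R := by
    have := Real.sq_sqrt (show 0 ≤ 1 + h by linarith)
    rw [hRdef]
    linarith
  have hE : ∀ x, 0 ≤ ⨆ y ∈ {y : V | Adj x y}, |f x - σ x y * f y| ^ 2 := fun x =>
    biSup_nonneg _ _ fun y => sq_nonneg _
  have hR0 : 0 ≤ R := by
    have : 1 ≤ Real.sqrt (1 + h) := Real.one_le_sqrt.2 (by linarith)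
    linarith
  rcases hR0.eq_or_lt with hR0 | hR0
  · rw [← hR0]
    simpa using Finset.sum_nonneg fun x _ => hE x
  have hR' : R ≤ 3 / 4 := by nlinarith
  set D : V → ℝ := fun x => Real.sqrt (⨆ y ∈ {y : V | Adj x y}, |f x - σ x y * f y| ^ 2)
    with hD
  have hD0 : ∀ x, 0 ≤ D x := fun x => Real.sqrt_nonneg _
  have hDsq : ∀ x, (⨆ y ∈ {y : V | Adj x y}, |f x - σ x y * f y| ^ 2) = D x ^ 2 := fun x =>
    (Real.sq_sqrt (hE x)).symm
  have hDle : ∀ x y, Adj x y → |f x - σ x y * f y| ≤ D x := fun x y hxy =>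
    Real.le_sqrt_of_sq_le (le_biSup_of_mem (fun y => |f x - σ x y * f y| ^ 2) _ hxy)
  set τ : V → ℝ := fun x => if 0 ≤ f x then 1 else -1 with hτdef
  have hτ : ∀ x, τ x = 1 ∨ τ x = -1 := fun x => by
    by_cases hx : 0 ≤ f x <;> simp [hτdef, hx]
  have hτf : ∀ x, f x = τ x * |f x| := fun x => by
    by_cases hx : 0 ≤ f x
    · simp [hτdef, hx, abs_of_nonneg]
    · simp [hτdef, hx, abs_of_neg (not_le.1 hx)]
  have hgood : ∀ x y, Adj x y → |f y| ≤ D x + |f x| := by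
    intro x y hxy
    have h1 := hDle x y hxy
    have h2 : |σ x y * f y| = |f y| := by
      rcases hσsign x y hxy with h | h <;> simp [h]
    have h3 := abs_sub_abs_le_abs_sub (σ x y * f y) (f x)
    rw [abs_sub_comm] at h3
    linarith
  have hbad : ∀ x y, Adj x y → τ x - σ x y * τ y ≠ 0 → |f x| + |f y| ≤ D x := by
    intro x y hxy hb
    refine le_trans ?_ (hDle x y hxy)
    have h1 : σ x y * τ y = -τ x := by
      revert hb
      rcases hσsign x y hxy with h | h <;> rcases hτ x with h' | h' <;>
        rcases hτ y with h'' | h'' <;> rw [h, h', h''] <;> norm_num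
    have h2 : f x - σ x y * f y = τ x * (|f x| + |f y|) := by
      calc f x - σ x y * f y = τ x * |f x| - σ x y * (τ y * |f y|) := by rw [← hτf, ← hτf]
        _ = τ x * |f x| - (σ x y * τ y) * |f y| := by ring
        _ = τ x * (|f x| + |f y|) := by rw [h1]; ring
    rw [h2, abs_mul]
    have h3 : |τ x| = 1 := by rcases hτ x with h | h <;> simp [h]
    rw [h3, one_mul]
    exact le_abs_self _
  set q : V → ℝ := fun x => if ∃ y, Adj x y ∧ τ x - σ x y * τ y ≠ 0
    then min (|f x| ^ 2) ((D x - |f x|) ^ 2) else 0 with hqdef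
  have key := hOutSigned_mul_sum_sq_le Adj σ hsymm hσsign f τ (fun x => (D x + |f x|) ^ 2) q hτ
    (fun x => by
      rw [← sq_abs]
      exact pow_le_pow_left₀ (abs_nonneg _) (by linarith [hD0 x]) 2)
    (fun x y hxy => by
      rw [← sq_abs]
      exact pow_le_pow_left₀ (abs_nonneg _) (hgood x y hxy) 2)
    (fun x => by
      simp only [hqdef]
      split_ifs <;> positivity)
    (fun x y hxy hb => by
      simp only [hqdef]
      rw [if_pos ⟨y, hxy, hb⟩, sq_abs, ← sq_abs (f y)]
      refine min_le_min le_rfl (pow_le_pow_left₀ (abs_nonneg _) ?_ 2)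
      linarith [hbad x y hxy hb])
  have hpt : ∀ x, R * ((D x + |f x|) ^ 2 - f x ^ 2 + 2 * q x) ≤
      (R + 1) * D x ^ 2 + R ^ 2 * f x ^ 2 := by
    intro x
    have hq : R * (2 * q x) ≤ (D x - R * |f x|) ^ 2 := by
      simp only [hqdef]
      split_ifs with hx
      · obtain ⟨y, hxy, hb⟩ := hx
        have h1 := hbad x y hxy hb
        have h2 := two_mul_min_sq_le hR0 hR' (abs_nonneg (f x))
          (show 0 ≤ D x - |f x| by linarith [abs_nonneg (f y)])
        simpa using h2
      · rw [mul_zero, mul_zero]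
        exact sq_nonneg _
    nlinarith [sq_abs (f x)]
  have hsum := Finset.sum_le_sum fun x (_ : x ∈ (Finset.univ : Finset V)) => hpt x
  rw [← Finset.mul_sum, Finset.sum_add_distrib (f := fun x => (R + 1) * D x ^ 2),
    ← Finset.mul_sum, ← Finset.mul_sum] at hsum
  simp only [hDsq]
  rw [← hh, hRh] at key
  have h6 := mul_le_mul_of_nonneg_left key hR0.le
  have h7 : (R + 1) * (R ^ 2 * ∑ x, f x ^ 2) ≤ (R + 1) * ∑ x, D x ^ 2 := by
    linarith
  exact le_of_mul_le_mul_left h7 (by linarith)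

lemma signedLap_isHermitian (d : ℕ) (hsymm : ∀ x y : V, Adj x y → Adj y x)
    (hσsymm : ∀ x y : V, σ x y = σ y x) : (signedLap Adj σ d).IsHermitian := by
  ext x y
  have h1 : Adj x y ↔ Adj y x := ⟨hsymm x y, hsymm y x⟩
  simp [signedLap, Matrix.conjTranspose_apply, hσsymm x y, h1, eq_comm]

lemma sum_biSup_le_of_eigen (d : ℕ)
    (hsymm : ∀ x y : V, Adj x y → Adj y x)
    (hσsign : ∀ x y : V, Adj x y → σ x y = 1 ∨ σ x y = -1)
    (hreg : ∀ x : V, (Finset.univ.filter fun y => Adj x y).card = d)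
    {f : V → ℝ} {r : ℝ} (hf : (signedLap Adj σ d).mulVec f = r • f) :
    ∑ x, (⨆ y ∈ {y : V | Adj x y}, |f x - σ x y * f y| ^ 2) ≤
      2 * (d : ℝ) * r * ∑ x, f x ^ 2 := by
  have hdeg : ∀ x, ∑ y, (if Adj x y then (1 : ℝ) else 0) = d := fun x => by
    rw [Finset.sum_boole, hreg]
  have hdeg' : ∀ y, ∑ x, (if Adj x y then (1 : ℝ) else 0) = d := fun y => by
    rw [← hdeg y]
    exact Finset.sum_congr rfl fun x _ => if_congr ⟨hsymm x y, hsymm y x⟩ rfl rfl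
  have hcross : ∀ x, ∑ y, (if Adj x y then σ x y * f y else 0) = d * (f x - r * f x) := by
    intro x
    rcases Nat.eq_zero_or_pos d with rfl | hd
    · have hx : ∀ y, ¬ Adj x y := by
        have := hreg x
        rw [Finset.card_eq_zero, Finset.filter_eq_empty_iff] at this
        exact fun y => this (Finset.mem_univ y)
      simp [hx]
    · have hd' : (d : ℝ) ≠ 0 := by exact_mod_cast hd.ne'
      have h1 := congrFun hf x
      simp only [Matrix.mulVec, dotProduct, signedLap, Matrix.of_apply, sub_mul,
        Finset.sum_sub_distrib, ite_mul, one_mul, zero_mul, Finset.sum_ite_eq, Finset.mem_univ,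
        if_true, Pi.smul_apply, smul_eq_mul] at h1
      rw [← h1, sub_sub_cancel, Finset.mul_sum]
      refine Finset.sum_congr rfl fun y _ => ?_
      split_ifs
      · field_simp
      · simp
  calc ∑ x, (⨆ y ∈ {y : V | Adj x y}, |f x - σ x y * f y| ^ 2)
      ≤ ∑ x, ∑ y, (if Adj x y then |f x - σ x y * f y| ^ 2 else 0) := by
        have hn : ∀ x y, 0 ≤ if Adj x y then |f x - σ x y * f y| ^ 2 else 0 := fun x y => by
          split_ifs <;> positivity
        refine Finset.sum_le_sum fun x _ => biSup_le_of_nonneg _ _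
          (Finset.sum_nonneg fun y _ => hn x y) fun y hy => ?_
        refine le_trans (le_of_eq ?_)
          (Finset.single_le_sum (fun y _ => hn x y) (Finset.mem_univ y))
        exact (if_pos hy).symm
    _ = ∑ x, ∑ y, (f x ^ 2 * (if Adj x y then 1 else 0) + f y ^ 2 * (if Adj x y then 1 else 0)
          - 2 * f x * (if Adj x y then σ x y * f y else 0)) := by
        refine Finset.sum_congr rfl fun x _ => Finset.sum_congr rfl fun y _ => ?_
        split_ifs with hxy
        · rw [sq_abs]
          rcases hσsign x y hxy with h | h <;> rw [h] <;> ring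
        · simp
    _ = 2 * (d : ℝ) * r * ∑ x, f x ^ 2 := by
        simp only [Finset.sum_add_distrib, Finset.sum_sub_distrib, ← Finset.mul_sum, hdeg, hcross]
        rw [Finset.sum_comm (f := fun x y => f y ^ 2 * (if Adj x y then (1 : ℝ) else 0))]
        simp only [← Finset.mul_sum, hdeg', ← Finset.sum_add_distrib, ← Finset.sum_sub_distrib]
        rw [Finset.mul_sum]
        exact Finset.sum_congr rfl fun x _ => by ring

lemma exists_eigen_signedLap [Nonempty V] (d : ℕ) (hsymm : ∀ x y : V, Adj x y → Adj y x)
    (hσsymm : ∀ x y : V, σ x y = σ y x) :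
    {r : ℝ | ∃ f : V → ℝ, f ≠ 0 ∧ (signedLap Adj σ d).mulVec f = r • f}.Nonempty := by
  have hH := signedLap_isHermitian Adj σ d hsymm hσsymm
  obtain ⟨i⟩ := ‹Nonempty V›
  refine ⟨hH.eigenvalues i, _, ?_, hH.mulVec_eigenvectorBasis i⟩
  intro h0
  refine hH.eigenvectorBasis.orthonormal.ne_zero i ?_
  ext j
  exact congrFun h0 j

end SignedGraph

/-- For a `d`-regular finite signed graph with the counting measure,
`2d λ₁^σ ≥ λ_∞^σ ≥ (√(1 + h_out^σ) − 1)²`. -/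
theorem signed_buser_cheeger {V : Type*} [Fintype V] (Adj : V → V → Prop) (σ : V → V → ℝ)
    (d : ℕ)
    (hsymm : ∀ x y : V, Adj x y → Adj y x)
    (hσsymm : ∀ x y : V, σ x y = σ y x)
    (hσsign : ∀ x y : V, Adj x y → σ x y = 1 ∨ σ x y = -1)
    (hreg : ∀ x : V, (Finset.univ.filter fun y => Adj x y).card = d) :
    2 * (d : ℝ) * lam1 Adj σ d ≥ lamInf Adj σ (fun _ => 1) ∧
    lamInf Adj σ (fun _ => 1) ≥
      (Real.sqrt (1 + hOutSigned Adj σ (fun _ => 1)) - 1) ^ 2 := by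
  rcases isEmpty_or_nonempty V with hV | hV
  · have h1 : lamInf Adj σ (fun _ => 1) = 0 := by simp [lamInf]
    have h2 : lam1 Adj σ d = 0 := by
      simp [lam1, Subsingleton.elim _ (0 : V → ℝ)]
    have h3 : hOutSigned Adj σ (fun _ => 1) = 0 := by
      simp [hOutSigned, Finset.eq_empty_of_isEmpty]
    rw [h1, h2, h3]
    simp
  have hmem : ∀ lam : ℝ, lam ∈ {lam : ℝ | ∀ f : V → ℝ,
      lam * ∑ x : V, f x ^ 2 * 1 ≤
        ∑ x : V, (⨆ y ∈ {y : V | Adj x y}, |f x - σ x y * f y| ^ 2) * 1} ↔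
      ∀ f : V → ℝ, lam * ∑ x : V, f x ^ 2 ≤
        ∑ x : V, (⨆ y ∈ {y : V | Adj x y}, |f x - σ x y * f y| ^ 2) := fun lam => by
    simp only [mul_one, Set.mem_ofPred_eq]
  have hbuser : ∀ r : ℝ, (∃ f : V → ℝ, f ≠ 0 ∧ (signedLap Adj σ d).mulVec f = r • f) →
      ∀ lam : ℝ, (∀ f : V → ℝ, lam * ∑ x : V, f x ^ 2 ≤
        ∑ x : V, (⨆ y ∈ {y : V | Adj x y}, |f x - σ x y * f y| ^ 2)) →
      lam ≤ 2 * (d : ℝ) * r := by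
    rintro r ⟨f, hf0, hf⟩ lam hlam
    obtain ⟨x, hx⟩ := Function.ne_iff.1 hf0
    have hpos : 0 < ∑ x, f x ^ 2 :=
      Finset.sum_pos' (fun x _ => sq_nonneg _) ⟨x, Finset.mem_univ x, sq_pos_iff.2 hx⟩
    exact le_of_mul_le_mul_right
      ((hlam f).trans (sum_biSup_le_of_eigen Adj σ d hsymm hσsign hreg hf)) hpos
  have hcheeger := (hmem _).2 (sq_mul_sum_sq_le Adj σ hsymm hσsign)
  obtain ⟨r₀, hr₀⟩ := exists_eigen_signedLap Adj σ d hsymm hσsymm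
  have hle : ∀ r : ℝ, (∃ f : V → ℝ, f ≠ 0 ∧ (signedLap Adj σ d).mulVec f = r • f) →
      lamInf Adj σ (fun _ => 1) ≤ 2 * (d : ℝ) * r := fun r hr =>
    csSup_le ⟨_, hcheeger⟩ fun lam hlam => hbuser r hr lam ((hmem lam).1 hlam)
  refine ⟨?_, le_csSup ⟨2 * (d : ℝ) * r₀, fun lam hlam => hbuser r₀ hr₀ lam ((hmem lam).1 hlam)⟩
    hcheeger⟩
  rcases Nat.eq_zero_or_pos d with rfl | hd
  · simpa using hle r₀ hr₀
  · have hd' : (0 : ℝ) < 2 * d := by positivity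
    rw [ge_iff_le, ← div_le_iff₀' hd']
    exact le_csInf ⟨r₀, hr₀⟩ fun r hr => (div_le_iff₀' hd').2 (hle r hr)
end

section
/- Let k ≥ 1 and let 𝒮_k = {ξ⁰, ξ¹, …, ξ^{k−1}} ⊂ ℂ be the set of k-th roots of unity, ξ = e^{2πi/k}. Let (G,σ) be a finite connection graph whose connection assigns to each oriented edge (x,y) a value σ_{xy} ∈ 𝒮_k with σ_{yx} = σ_{xy}⁻¹, equipped with a vertex measure π : V → ℝ_{>0}. Then λ_∞^σ ≥ (√(1 + (1/2)·h_out^σ) − 1)². -/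
attribute [local instance] Classical.propDecidable

/-- The Poincaré-type constant `λ_∞^σ` of a `U(1)`-connection graph with vertex measure `π`:
the largest `λ` with `λ ∑ |f(x)|² π(x) ≤ ∑ sup_{y∼x} |f(x) − σ_{xy} f(y)|² π(x)` for all
`f : V → ℂ`. -/
noncomputable def lamInfC1 {V : Type*} [Fintype V] (Adj : V → V → Prop)
    (σ : V → V → ℂ) (π : V → ℝ) : ℝ :=
  sSup {lam : ℝ | ∀ f : V → ℂ,
    lam * ∑ x : V, ‖f x‖ ^ 2 * π x ≤
      ∑ x : V, (⨆ y ∈ {y : V | Adj x y}, ‖f x - σ x y * f y‖ ^ 2) * π x}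

/-- The `∞`-frustration index `ι_∞^{σ,π}(U)` of a subset `U`, where the switching functions
take values in the `k`-th roots of unity `𝒮_k`. -/
noncomputable def iotaInfC1 {V : Type*} [Fintype V] (k : ℕ) (Adj : V → V → Prop)
    (σ : V → V → ℂ) (π : V → ℝ) (U : Finset V) : ℝ :=
  sInf {r : ℝ | ∃ τ : V → ℂ, (∀ x : V, τ x ^ k = 1) ∧
    r = (1 / 2) * ∑ x ∈ U,
      (⨆ y ∈ {y : V | y ∈ U ∧ Adj x y}, ‖τ x - σ x y * τ y‖) * π x}

/-- The outer vertex isoperimetric constant `h_out^σ` of a connection graph with a `k`-cyclic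
group connection. -/
noncomputable def hOutC1 {V : Type*} [Fintype V] (k : ℕ) (Adj : V → V → Prop)
    (σ : V → V → ℂ) (π : V → ℝ) : ℝ :=
  sInf {r : ℝ | ∃ U : Finset V, U.Nonempty ∧
    r = (2 * iotaInfC1 k Adj σ π U + ∑ y ∈ outBd Adj U, π y) / ∑ x ∈ U, π x}

open Real MeasureTheory in
theorem integral_floor_sub_floor (a b : ℝ) :
    ∫ θ in (0 : ℝ)..1, ((⌊a + θ⌋ : ℝ) - ⌊b + θ⌋) = a - b := by
  have hmono : ∀ c : ℝ, Monotone fun θ : ℝ => (⌊c + θ⌋ : ℝ) := fun c x y hxy =>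
    Int.cast_le.mpr (Int.floor_mono (by linarith))
  have hfract : ∀ c : ℝ, ∫ θ in (0 : ℝ)..1, Int.fract (c + θ) = ∫ θ in (0 : ℝ)..1, Int.fract θ := by
    intro c
    rw [intervalIntegral.integral_comp_add_left (f := fun x : ℝ => Int.fract x)]
    simpa using (Int.fract_periodic ℝ).intervalIntegral_add_eq c 0
  have hfloor : ∀ c : ℝ, ∫ θ in (0 : ℝ)..1, (⌊c + θ⌋ : ℝ)
      = c + 1 / 2 - ∫ θ in (0 : ℝ)..1, Int.fract θ := by
    intro c
    have hlin : ∫ θ in (0 : ℝ)..1, (c + θ) = c + 1 / 2 := by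
      rw [intervalIntegral.integral_add (by simp) (by simp)]
      simp
    have hint : IntervalIntegrable (fun θ : ℝ => c + θ) volume 0 1 :=
      Continuous.intervalIntegrable (by fun_prop) _ _
    rw [← hlin, ← hfract c, eq_sub_iff_add_eq, ← intervalIntegral.integral_add]
    · exact intervalIntegral.integral_congr fun θ _ => Int.floor_add_fract _
    · exact (hmono c).intervalIntegrable
    · simp only [← Int.self_sub_floor]
      exact hint.sub (hmono c).intervalIntegrable
  rw [intervalIntegral.integral_sub (hmono a).intervalIntegrable (hmono b).intervalIntegrable,
    hfloor, hfloor]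
  ring

theorem Complex.norm_exp_I_mul_sub_exp_I_mul_le (a b : ℝ) :
    ‖Complex.exp (Complex.I * a) - Complex.exp (Complex.I * b)‖ ≤ |a - b| := by
  have h : Complex.exp (Complex.I * a) - Complex.exp (Complex.I * b)
      = Complex.exp (Complex.I * b) * (Complex.exp (Complex.I * ((a - b : ℝ) : ℂ)) - 1) := by
    rw [mul_sub, ← Complex.exp_add, mul_one]
    congr 2
    push_cast
    ring
  rw [h, norm_mul, Complex.norm_exp_I_mul_ofReal, one_mul]
  exact Real.norm_exp_I_mul_ofReal_sub_one_le

theorem Complex.exists_arg_mul_eq {z w : ℂ} (hz : z ≠ 0) (hw : w ≠ 0) :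
    ∃ m : ℤ, (z * w).arg = z.arg + w.arg + 2 * Real.pi * m := by
  have h := Complex.arg_mul_coe_angle hz hw
  rw [← Real.Angle.coe_add, Real.Angle.angle_eq_iff_two_pi_dvd_sub] at h
  obtain ⟨m, hm⟩ := h
  exact ⟨m, by linarith⟩

/-- A complex number at distance at most `r < 1` from `1` has argument at most `r + r² / 2`,
as long as the latter is at most `1`. -/
theorem Complex.abs_arg_le_of_norm_sub_one_le {u : ℂ} {r : ℝ} (hr : 0 ≤ r)
    (hr1 : r + r ^ 2 / 2 ≤ 1) (hu : ‖u - 1‖ ≤ r) : |u.arg| ≤ r + r ^ 2 / 2 := by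
  have hrlt : r < 1 := by nlinarith
  have hsq : (u.re - 1) ^ 2 + u.im ^ 2 ≤ r ^ 2 := by
    have h := pow_le_pow_left₀ (norm_nonneg _) hu 2
    rw [← Complex.normSq_eq_norm_sq, Complex.normSq_apply] at h
    simp at h
    nlinarith
  have hre : 0 < u.re := by nlinarith [sq_nonneg u.im]
  have hu0 : 0 < ‖u‖ := norm_pos_iff.mpr fun h => by simp [h] at hre
  have hnorm : ‖u‖ ^ 2 = u.re ^ 2 + u.im ^ 2 := by
    rw [← Complex.normSq_eq_norm_sq, Complex.normSq_apply]; ring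
  have him : u.im ^ 2 ≤ (r * ‖u‖) ^ 2 := by
    rw [mul_pow, hnorm]
    nlinarith [sq_nonneg (u.re - (1 - r ^ 2)), mul_le_mul_of_nonneg_left hsq
      (show 0 ≤ 1 - r ^ 2 by nlinarith)]
  have habs : |u.im / ‖u‖| ≤ r := by
    rw [abs_div, abs_norm, div_le_iff₀ hu0]
    exact abs_le_of_sq_le_sq him (by positivity)
  have hsin : r ≤ Real.sin (r + r ^ 2 / 2) := by
    refine le_trans ?_ (Real.sin_ge_sub_cube (by positivity))
    have h1 : (r + r ^ 2 / 2) ^ 3 ≤ (r + r ^ 2 / 2) * r * (1 + r / 2) ^ 2 * r := by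
      apply le_of_eq; ring
    have h2 : (1 + r / 2) ^ 2 ≤ 3 := by nlinarith
    have h3 : (r + r ^ 2 / 2) * r ^ 2 * (1 + r / 2) ^ 2 ≤ 1 * r ^ 2 * 3 := by gcongr
    nlinarith
  have hpi := Real.pi_gt_three
  rw [Complex.arg_of_re_nonneg hre.le]
  rw [abs_le] at habs ⊢
  have hq : 0 ≤ r ^ 2 / 2 := by positivity
  constructor
  · rw [Real.le_arcsin_iff_sin_le' ⟨by linarith, by linarith⟩, Real.sin_neg]
    linarith
  · rw [Real.arcsin_le_iff_le_sin' ⟨by linarith, by linarith⟩]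
    linarith

/-- The `k`-th root of unity attached to the sector of angle `2π / k` containing the angle `s`,
where the subdivision into sectors is rotated by `-2πθ / k`. -/
noncomputable def sectorRoot (k : ℕ) (θ s : ℝ) : ℂ :=
  Complex.exp (Complex.I * ((2 * Real.pi / k * ⌊k * s / (2 * Real.pi) + θ⌋ : ℝ) : ℂ))

theorem sectorRoot_pow {k : ℕ} (hk : 1 ≤ k) (θ s : ℝ) : sectorRoot k θ s ^ k = 1 := by
  have hk0 : (k : ℂ) ≠ 0 := by exact_mod_cast (by omega : k ≠ 0)
  rw [sectorRoot, ← Complex.exp_nat_mul, Complex.exp_eq_one_iff]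
  refine ⟨⌊k * s / (2 * Real.pi) + θ⌋, ?_⟩
  push_cast
  field_simp

theorem norm_sectorRoot (k : ℕ) (θ s : ℝ) : ‖sectorRoot k θ s‖ = 1 :=
  Complex.norm_exp_I_mul_ofReal _

theorem sectorRoot_add_div {k : ℕ} (hk : 1 ≤ k) (θ s : ℝ) (n : ℤ) :
    sectorRoot k θ (s + 2 * Real.pi / k * n)
      = Complex.exp (Complex.I * ((2 * Real.pi / k * n : ℝ) : ℂ)) * sectorRoot k θ s := by
  have hk0 : (k : ℝ) ≠ 0 := by exact_mod_cast (by omega : k ≠ 0)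
  have h : k * (s + 2 * Real.pi / k * n) / (2 * Real.pi) + θ
      = (k * s / (2 * Real.pi) + θ) + n := by
    field_simp
    ring
  rw [sectorRoot, sectorRoot, h, Int.floor_add_intCast, ← Complex.exp_add]
  congr 1
  push_cast
  ring

theorem sectorRoot_add_two_pi_mul {k : ℕ} (hk : 1 ≤ k) (θ s : ℝ) (m : ℤ) :
    sectorRoot k θ (s + 2 * Real.pi * m) = sectorRoot k θ s := by
  have hk0 : (k : ℝ) ≠ 0 := by exact_mod_cast (by omega : k ≠ 0)
  have h : 2 * Real.pi * m = 2 * Real.pi / k * ((k * m : ℤ) : ℝ) := by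
    push_cast
    field_simp
  rw [h, sectorRoot_add_div hk, ← h]
  have : Complex.exp (Complex.I * ((2 * Real.pi * m : ℝ) : ℂ)) = 1 :=
    Complex.exp_eq_one_iff.mpr ⟨m, by push_cast; ring⟩
  rw [this, one_mul]

theorem sectorRoot_arg_mul {k : ℕ} (hk : 1 ≤ k) (θ : ℝ) {σ z : ℂ} (hσ : σ ^ k = 1) (hz : z ≠ 0) :
    sectorRoot k θ (σ * z).arg = σ * sectorRoot k θ z.arg := by
  have hk0 : (k : ℂ) ≠ 0 := by exact_mod_cast (by omega : k ≠ 0)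
  have hnorm : ‖σ‖ = 1 := Complex.norm_eq_one_of_pow_eq_one hσ (by omega)
  have hσ0 : σ ≠ 0 := fun h => by simp [h] at hnorm
  have hexp : Complex.exp (σ.arg * Complex.I) = σ := by
    simpa [hnorm] using Complex.norm_mul_exp_arg_mul_I σ
  have hpow := hσ
  rw [← hexp, ← Complex.exp_nat_mul, Complex.exp_eq_one_iff] at hpow
  obtain ⟨n, hn⟩ := hpow
  have harg : (σ.arg : ℂ) = ((2 * Real.pi / k * n : ℝ) : ℂ) := by
    push_cast
    field_simp
    apply mul_right_cancel₀ Complex.I_ne_zero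
    linear_combination hn
  obtain ⟨m, hm⟩ := Complex.exists_arg_mul_eq hσ0 hz
  rw [hm, sectorRoot_add_two_pi_mul hk, add_comm, Complex.ofReal_injective harg,
    sectorRoot_add_div hk, ← harg, mul_comm Complex.I, hexp]

/-- Averaged over the rotation `θ`, the largest change of `sectorRoot` on a disc of radius `M`
around `z ≠ 0` is at most `2 M / |z| + (M / |z|)²`. -/
theorem exists_sectorRoot_sub_bound {k : ℕ} (hk : 1 ≤ k) {z : ℂ} (hz : z ≠ 0) {M : ℝ}
    (hM : 0 ≤ M) :
    ∃ G : ℝ → ℝ, IntervalIntegrable G MeasureTheory.volume 0 1 ∧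
      ∫ θ in (0 : ℝ)..1, G θ ≤ 2 * (M / ‖z‖) + (M / ‖z‖) ^ 2 ∧
      ∀ θ : ℝ, ∀ w : ℂ, ‖z - w‖ ≤ M →
        ‖sectorRoot k θ z.arg - sectorRoot k θ w.arg‖ ≤ G θ := by
  have hz0 : 0 < ‖z‖ := norm_pos_iff.mpr hz
  have hkpos : (0 : ℝ) < k := by exact_mod_cast hk
  have hpi := Real.pi_pos
  set r := M / ‖z‖ with hr
  have hr0 : 0 ≤ r := by positivity
  rcases le_total 1 (r + r ^ 2 / 2) with h1 | h1
  · refine ⟨fun _ => 2, by simp, by simp; linarith, fun θ w _ => ?_⟩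
    refine (norm_sub_le _ _).trans ?_
    rw [norm_sectorRoot, norm_sectorRoot]
    norm_num
  · set p := k * z.arg / (2 * Real.pi) with hp
    set A := k * (r + r ^ 2 / 2) / (2 * Real.pi) with hA
    refine ⟨fun θ => 2 * Real.pi / k * ((⌊(p + A) + θ⌋ : ℝ) - ⌊(p - A) + θ⌋), ?_, ?_, ?_⟩
    · have hmono : ∀ c : ℝ, Monotone fun θ : ℝ => (⌊c + θ⌋ : ℝ) := fun c x y hxy =>
        Int.cast_le.mpr (Int.floor_mono (by linarith))
      exact ((hmono _).intervalIntegrable.sub (hmono _).intervalIntegrable).const_mul _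
    · rw [intervalIntegral.integral_const_mul, integral_floor_sub_floor]
      apply le_of_eq
      rw [hA]
      field_simp
      ring
    · intro θ w hw
      have hquot : ‖w / z - 1‖ ≤ r := by
        rw [div_sub_one hz, norm_div, norm_sub_rev]
        exact div_le_div_of_nonneg_right hw hz0.le
      have hrlt : r < 1 := by nlinarith
      have hw0 : w / z ≠ 0 := by
        intro h
        rw [h] at hquot
        norm_num at hquot
        linarith
      have harg := abs_le.mp (Complex.abs_arg_le_of_norm_sub_one_le hr0 h1 hquot)
      obtain ⟨m, hm⟩ := Complex.exists_arg_mul_eq hw0 hz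
      rw [div_mul_cancel₀ _ hz] at hm
      rw [hm, sectorRoot_add_two_pi_mul hk, sectorRoot, sectorRoot]
      refine (Complex.norm_exp_I_mul_sub_exp_I_mul_le _ _).trans ?_
      rw [← mul_sub, abs_mul, abs_of_pos (by positivity)]
      refine mul_le_mul_of_nonneg_left ?_ (by positivity)
      have hfloor : ∀ {a b : ℝ}, a ≤ b → (⌊a⌋ : ℝ) ≤ ⌊b⌋ := fun h =>
        Int.cast_le.mpr (Int.floor_mono h)
      have e : k * ((w / z).arg + z.arg) / (2 * Real.pi)
          = p + k * (w / z).arg / (2 * Real.pi) := by rw [hp]; ring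
      have hub : k * (w / z).arg / (2 * Real.pi) ≤ A := by
        rw [hA]; gcongr; exact harg.2
      have hlb : -A ≤ k * (w / z).arg / (2 * Real.pi) := by
        rw [hA, ← neg_div, ← mul_neg]; gcongr; exact harg.1
      have hA0 : 0 ≤ A := by positivity
      rw [e, abs_le]
      have h1 := hfloor (show p + k * (w / z).arg / (2 * Real.pi) + θ ≤ p + A + θ by linarith)
      have h2 := hfloor (show p - A + θ ≤ p + k * (w / z).arg / (2 * Real.pi) + θ by linarith)
      have h3 := hfloor (show p + θ ≤ p + A + θ by linarith)
      have h4 := hfloor (show p - A + θ ≤ p + θ by linarith)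
      constructor <;> linarith

theorem Finset.sum_mul_le_sum_mul_of_superlevel {ι : Type*} (s : Finset ι) {a b c d : ι → ℝ}
    (ha : ∀ x ∈ s, 0 ≤ a x) (hb : ∀ x ∈ s, 0 ≤ b x)
    (h : ∀ t : ℝ, 0 < t → ∑ x ∈ s, (if t ≤ a x then c x else 0)
      ≤ ∑ x ∈ s, if t ≤ b x then d x else 0) :
    ∑ x ∈ s, c x * a x ≤ ∑ x ∈ s, d x * b x := by
  set T := ∑ x ∈ s, a x + ∑ x ∈ s, b x with hT
  have hSa := Finset.sum_nonneg ha
  have hSb := Finset.sum_nonneg hb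
  have haT : ∀ x ∈ s, a x ∈ Set.Icc 0 T := fun x hx =>
    ⟨ha x hx, (Finset.single_le_sum ha hx).trans (by linarith)⟩
  have hbT : ∀ x ∈ s, b x ∈ Set.Icc 0 T := fun x hx =>
    ⟨hb x hx, (Finset.single_le_sum hb hx).trans (by linarith)⟩
  have hint : ∀ u v : ℝ, IntervalIntegrable (fun t : ℝ => if t ≤ u then v else 0)
      MeasureTheory.volume 0 T := fun u v => by
    have : (fun t : ℝ => if t ≤ u then v else 0) = {t | t ≤ u}.indicator fun _ => v := by
      ext t; simp [Set.indicator]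
    rw [this, intervalIntegrable_iff]
    exact (intervalIntegrable_iff.mp intervalIntegrable_const).indicator measurableSet_Iic
  have hval : ∀ u v : ℝ, u ∈ Set.Icc 0 T →
      ∫ t in (0 : ℝ)..T, (if t ≤ u then v else 0) = v * u := fun u v hu => by
    have : (fun t : ℝ => if t ≤ u then v else 0) = {t | t ≤ u}.indicator fun _ => v := by
      ext t; simp [Set.indicator]
    rw [this, intervalIntegral.integral_indicator hu]
    simp [mul_comm]
  have key := intervalIntegral.integral_mono_on_of_le_Ioo (a := 0) (b := T) (by positivity)
    (IntervalIntegrable.sum s (f := fun x t => if t ≤ a x then c x else 0) fun x _ => hint _ _)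
    (IntervalIntegrable.sum s (f := fun x t => if t ≤ b x then d x else 0) fun x _ => hint _ _)
    (fun t ht => by simpa using h t ht.1)
  simp only [Finset.sum_apply] at key
  rw [intervalIntegral.integral_finsetSum fun x _ => hint _ _,
    intervalIntegral.integral_finsetSum fun x _ => hint _ _,
    Finset.sum_congr rfl fun x hx => hval _ _ (haT x hx),
    Finset.sum_congr rfl fun x hx => hval _ _ (hbT x hx)] at key
  exact key

theorem iotaInfC1_nonneg {V : Type*} [Fintype V] (k : ℕ) (Adj : V → V → Prop)
    (σ : V → V → ℂ) {π : V → ℝ} (hπ : ∀ x : V, 0 < π x) (U : Finset V) :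
    0 ≤ iotaInfC1 k Adj σ π U := by
  refine Real.sInf_nonneg ?_
  rintro r ⟨τ, -, rfl⟩
  refine mul_nonneg (by norm_num) (Finset.sum_nonneg fun x _ => mul_nonneg ?_ (hπ x).le)
  exact Real.iSup_nonneg fun y => Real.iSup_nonneg fun _ => norm_nonneg _

theorem hOutC1_ratio_nonneg {V : Type*} [Fintype V] (k : ℕ) (Adj : V → V → Prop)
    (σ : V → V → ℂ) {π : V → ℝ} (hπ : ∀ x : V, 0 < π x) (U : Finset V) :
    0 ≤ (2 * iotaInfC1 k Adj σ π U + ∑ y ∈ outBd Adj U, π y) / ∑ x ∈ U, π x :=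
  div_nonneg (add_nonneg (mul_nonneg (by norm_num) (iotaInfC1_nonneg k Adj σ hπ U))
    (Finset.sum_nonneg fun x _ => (hπ x).le)) (Finset.sum_nonneg fun x _ => (hπ x).le)

theorem hOutC1_nonneg {V : Type*} [Fintype V] (k : ℕ) (Adj : V → V → Prop)
    (σ : V → V → ℂ) {π : V → ℝ} (hπ : ∀ x : V, 0 < π x) : 0 ≤ hOutC1 k Adj σ π := by
  refine Real.sInf_nonneg ?_
  rintro r ⟨U, -, rfl⟩
  exact hOutC1_ratio_nonneg k Adj σ hπ U

theorem hOutC1_mul_sum_le {V : Type*} [Fintype V] (k : ℕ) (Adj : V → V → Prop)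
    (σ : V → V → ℂ) {π : V → ℝ} (hπ : ∀ x : V, 0 < π x) (U : Finset V) {τ : V → ℂ}
    (hτ : ∀ x : V, τ x ^ k = 1) :
    hOutC1 k Adj σ π * ∑ x ∈ U, π x ≤
      ∑ x ∈ U, (⨆ y ∈ {y : V | y ∈ U ∧ Adj x y}, ‖τ x - σ x y * τ y‖) * π x
        + ∑ y ∈ outBd Adj U, π y := by
  rcases U.eq_empty_or_nonempty with rfl | hU
  · simpa using Finset.sum_nonneg fun x _ => (hπ x).le
  have hpos : 0 < ∑ x ∈ U, π x := Finset.sum_pos (fun x _ => hπ x) hU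
  have hh : hOutC1 k Adj σ π ≤
      (2 * iotaInfC1 k Adj σ π U + ∑ y ∈ outBd Adj U, π y) / ∑ x ∈ U, π x := by
    refine csInf_le ⟨0, ?_⟩ ⟨U, hU, rfl⟩
    rintro r ⟨W, -, rfl⟩
    exact hOutC1_ratio_nonneg k Adj σ hπ W
  have hι : iotaInfC1 k Adj σ π U ≤ (1 / 2) * ∑ x ∈ U,
      (⨆ y ∈ {y : V | y ∈ U ∧ Adj x y}, ‖τ x - σ x y * τ y‖) * π x := by
    refine csInf_le ⟨0, ?_⟩ ⟨τ, hτ, rfl⟩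
    rintro r ⟨τ', -, rfl⟩
    refine mul_nonneg (by norm_num) (Finset.sum_nonneg fun x _ => mul_nonneg ?_ (hπ x).le)
    exact Real.iSup_nonneg fun y => Real.iSup_nonneg fun _ => norm_nonneg _
  rw [le_div_iff₀ hpos] at hh
  linarith

/-- The Cheeger-type estimate on the superlevel set `{x | t ≤ |f x|²}`, where `M x` bounds the
variation of `f` at `x` along edges. -/
theorem hOutC1_superlevel_le {V : Type*} [Fintype V] {k : ℕ} (hk : 1 ≤ k)
    {Adj : V → V → Prop} {σ : V → V → ℂ} {π : V → ℝ}
    (hπ : ∀ x : V, 0 < π x) (hsymm : ∀ x y : V, Adj x y → Adj y x)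
    (hroot : ∀ x y : V, Adj x y → σ x y ^ k = 1)
    {f : V → ℂ} {M : V → ℝ} (hM : ∀ x, 0 ≤ M x)
    (hfM : ∀ x y, Adj x y → ‖f x - σ x y * f y‖ ≤ M x) {t : ℝ} (ht : 0 < t) :
    ∑ x, (if t ≤ ‖f x‖ ^ 2 then
        (hOutC1 k Adj σ π + 1 - (2 * (M x / ‖f x‖) + (M x / ‖f x‖) ^ 2)) * π x else 0)
      ≤ ∑ x, if t ≤ (‖f x‖ + M x) ^ 2 then π x else 0 := by
  set h := hOutC1 k Adj σ π with hh
  set U : Finset V := Finset.univ.filter fun x => t ≤ ‖f x‖ ^ 2 with hU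
  have hf0 : ∀ x ∈ U, f x ≠ 0 := by
    intro x hx h0
    simp [hU, h0] at hx
    linarith
  have hG : ∀ x, ∃ G : ℝ → ℝ, x ∈ U → IntervalIntegrable G MeasureTheory.volume 0 1 ∧
      ∫ θ in (0 : ℝ)..1, G θ ≤ 2 * (M x / ‖f x‖) + (M x / ‖f x‖) ^ 2 ∧
      ∀ θ : ℝ, ∀ w : ℂ, ‖f x - w‖ ≤ M x →
        ‖sectorRoot k θ (f x).arg - sectorRoot k θ w.arg‖ ≤ G θ := by
    intro x
    by_cases hx : x ∈ U
    · obtain ⟨G, hG⟩ := exists_sectorRoot_sub_bound hk (hf0 x hx) (hM x)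
      exact ⟨G, fun _ => hG⟩
    · exact ⟨0, fun hx' => absurd hx' hx⟩
  choose G hG using hG
  have hθ : ∀ θ : ℝ, h * ∑ x ∈ U, π x ≤ ∑ x ∈ U, G x θ * π x + ∑ y ∈ outBd Adj U, π y := by
    intro θ
    refine (hOutC1_mul_sum_le k Adj σ hπ U (τ := fun x => sectorRoot k θ (f x).arg)
      fun x => sectorRoot_pow hk θ _).trans ?_
    refine add_le_add_left (Finset.sum_le_sum fun x hx => ?_) _
    refine mul_le_mul_of_nonneg_right ?_ (hπ x).le
    have hG0 : 0 ≤ G x θ := (norm_nonneg _).trans ((hG x hx).2.2 θ (f x) (by simpa using hM x))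
    refine Real.iSup_le (fun y => Real.iSup_le (fun hy => ?_) hG0) hG0
    rw [← sectorRoot_arg_mul hk θ (hroot x y hy.2) (hf0 y hy.1)]
    exact (hG x hx).2.2 θ _ (hfM x y hy.2)
  have hint : ∀ x ∈ U, IntervalIntegrable (fun θ => G x θ * π x) MeasureTheory.volume 0 1 :=
    fun x hx => (hG x hx).1.mul_const _
  have hsumint : IntervalIntegrable (fun θ => ∑ x ∈ U, G x θ * π x) MeasureTheory.volume 0 1 := by
    simpa only [Finset.sum_fn] using
      IntervalIntegrable.sum U (f := fun x θ => G x θ * π x) hint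
  have havg : h * ∑ x ∈ U, π x ≤
      ∑ x ∈ U, (2 * (M x / ‖f x‖) + (M x / ‖f x‖) ^ 2) * π x + ∑ y ∈ outBd Adj U, π y := by
    have key := intervalIntegral.integral_mono_on (a := 0) (b := 1) zero_le_one
      intervalIntegrable_const (hsumint.add intervalIntegrable_const) fun θ _ => hθ θ
    rw [intervalIntegral.integral_add hsumint intervalIntegrable_const,
      intervalIntegral.integral_finsetSum hint] at key
    simp only [intervalIntegral.integral_const, sub_zero, one_smul,
      intervalIntegral.integral_mul_const] at key
    refine key.trans (add_le_add_left (Finset.sum_le_sum fun x hx => ?_) _)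
    exact mul_le_mul_of_nonneg_right (hG x hx).2.1 (hπ x).le
  have hbd : ∑ x ∈ U, π x + ∑ y ∈ outBd Adj U, π y
      ≤ ∑ x, if t ≤ (‖f x‖ + M x) ^ 2 then π x else 0 := by
    have hdisj : Disjoint U (outBd Adj U) :=
      Finset.disjoint_right.mpr fun x hx => (Finset.mem_filter.mp hx).2.1
    rw [← Finset.sum_union hdisj, ← Finset.sum_filter]
    refine Finset.sum_le_sum_of_subset_of_nonneg ?_ fun x _ _ => (hπ x).le
    intro x hx
    simp only [Finset.mem_filter, Finset.mem_univ, true_and]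
    rcases Finset.mem_union.mp hx with hx | hx
    · refine (Finset.mem_filter.mp hx).2.trans ?_
      gcongr
      linarith [hM x]
    · obtain ⟨-, y, hy, hyx⟩ := (Finset.mem_filter.mp hx).2
      have hxy := hsymm y x hyx
      refine (Finset.mem_filter.mp hy).2.trans ?_
      gcongr
      have hnorm : ‖σ x y‖ = 1 := Complex.norm_eq_one_of_pow_eq_one (hroot x y hxy) (by omega)
      calc ‖f y‖ = ‖σ x y * f y‖ := by rw [norm_mul, hnorm, one_mul]
        _ ≤ ‖f x‖ + ‖f x - σ x y * f y‖ := norm_le_insert _ _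
        _ ≤ ‖f x‖ + M x := by gcongr; exact hfM x y hxy
  rw [← Finset.sum_filter, ← hU]
  have hsplit : ∑ x ∈ U, (h + 1 - (2 * (M x / ‖f x‖) + (M x / ‖f x‖) ^ 2)) * π x
      = h * ∑ x ∈ U, π x + ∑ x ∈ U, π x
        - ∑ x ∈ U, (2 * (M x / ‖f x‖) + (M x / ‖f x‖) ^ 2) * π x := by
    rw [Finset.mul_sum, ← Finset.sum_add_distrib, ← Finset.sum_sub_distrib]
    exact Finset.sum_congr rfl fun x _ => by ring
  rw [hsplit]
  linarith

theorem hOutC1_mul_sum_sq_le {V : Type*} [Fintype V] {k : ℕ} (hk : 1 ≤ k)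
    {Adj : V → V → Prop} {σ : V → V → ℂ} {π : V → ℝ}
    (hπ : ∀ x : V, 0 < π x) (hsymm : ∀ x y : V, Adj x y → Adj y x)
    (hroot : ∀ x y : V, Adj x y → σ x y ^ k = 1)
    {f : V → ℂ} {M : V → ℝ} (hM : ∀ x, 0 ≤ M x)
    (hfM : ∀ x y, Adj x y → ‖f x - σ x y * f y‖ ≤ M x) :
    hOutC1 k Adj σ π * ∑ x, ‖f x‖ ^ 2 * π x
      ≤ 4 * ∑ x, ‖f x‖ * M x * π x + 2 * ∑ x, M x ^ 2 * π x := by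
  have key := Finset.sum_mul_le_sum_mul_of_superlevel Finset.univ
    (a := fun x => ‖f x‖ ^ 2) (b := fun x => (‖f x‖ + M x) ^ 2)
    (fun x _ => by positivity) (fun x _ => by positivity)
    (fun t ht => hOutC1_superlevel_le hk hπ hsymm hroot hM hfM ht)
  rw [← sub_nonneg, ← Finset.sum_sub_distrib] at key
  rw [← sub_nonneg, Finset.mul_sum, Finset.mul_sum, Finset.mul_sum, ← Finset.sum_add_distrib,
    ← Finset.sum_sub_distrib]
  refine key.trans (Finset.sum_le_sum fun x _ => ?_)
  rcases eq_or_ne ‖f x‖ 0 with h0 | h0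
  · simp only [h0]
    nlinarith [mul_nonneg (sq_nonneg (M x)) (hπ x).le]
  · apply le_of_eq
    field_simp
    ring

/-- For a finite connection graph with a `k`-cyclic group connection (all `σ_{xy}` are `k`-th
roots of unity, `σ_{yx} = σ_{xy}⁻¹`) and positive vertex measure `π`,
`λ_∞^σ ≥ (√(1 + h_out^σ/2) − 1)²`. -/
theorem lamInfC1_ge_hOutC1_bound {V : Type*} [Fintype V] (k : ℕ) (hk : 1 ≤ k)
    (Adj : V → V → Prop) (σ : V → V → ℂ) (π : V → ℝ)
    (hπ : ∀ x : V, 0 < π x)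
    (hsymm : ∀ x y : V, Adj x y → Adj y x)
    (hroot : ∀ x y : V, Adj x y → σ x y ^ k = 1)
    (hinv : ∀ x y : V, Adj x y → σ y x = (σ x y)⁻¹) :
    lamInfC1 Adj σ π ≥
      (Real.sqrt (1 + 1 / 2 * hOutC1 k Adj σ π) - 1) ^ 2 := by
  rcases isEmpty_or_nonempty V with hV | hV
  · have hU : ∀ U : Finset V, ¬ U.Nonempty := fun U ⟨x, _⟩ => hV.elim x
    simp [lamInfC1, hOutC1, hU]
  refine le_csSup ?_ fun f => ?_
  · have hpos : 0 < ∑ x, π x := Finset.sum_pos (fun x _ => hπ x) Finset.univ_nonempty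
    refine ⟨(∑ x : V, (⨆ y ∈ {y : V | Adj x y}, ‖(1 : ℂ) - σ x y * 1‖ ^ 2) * π x)
      / ∑ x, π x, fun lam hlam => ?_⟩
    rw [le_div_iff₀ hpos]
    simpa using hlam fun _ => 1
  set Q : V → ℝ := fun x => ⨆ y ∈ {y : V | Adj x y}, ‖f x - σ x y * f y‖ ^ 2 with hQ
  have hQ0 : ∀ x, 0 ≤ Q x := fun x =>
    Real.iSup_nonneg fun y => Real.iSup_nonneg fun _ => by positivity
  have hfM : ∀ x y, Adj x y → ‖f x - σ x y * f y‖ ≤ √(Q x) := by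
    intro x y hxy
    refine Real.le_sqrt_of_sq_le ?_
    have h1 := le_ciSup (f := fun y => ⨆ _ : y ∈ {y : V | Adj x y}, ‖f x - σ x y * f y‖ ^ 2)
      (Set.finite_range _).bddAbove y
    have h2 : y ∈ {y : V | Adj x y} := hxy
    simpa only [ciSup_pos h2] using h1
  have key := hOutC1_mul_sum_sq_le hk hπ hsymm hroot (fun x => Real.sqrt_nonneg (Q x)) hfM
  simp only [Real.sq_sqrt (hQ0 _)] at key
  change _ ≤ ∑ x, Q x * π x
  set S := ∑ x, ‖f x‖ ^ 2 * π x with hS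
  set R := ∑ x, Q x * π x with hR
  set C := ∑ x, ‖f x‖ * √(Q x) * π x with hC
  have hS0 : 0 ≤ S := Finset.sum_nonneg fun x _ => mul_nonneg (sq_nonneg _) (hπ x).le
  have hR0 : 0 ≤ R := Finset.sum_nonneg fun x _ => mul_nonneg (hQ0 x) (hπ x).le
  have hCS : C ≤ √S * √R := by
    rw [← Real.sqrt_mul hS0]
    refine Real.le_sqrt_of_sq_le (Finset.sum_sq_le_sum_mul_sum_of_sq_le_mul _
      (fun x _ => mul_nonneg (sq_nonneg _) (hπ x).le)
      (fun x _ => mul_nonneg (hQ0 x) (hπ x).le) fun x _ => le_of_eq ?_)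
    rw [mul_pow, mul_pow, Real.sq_sqrt (hQ0 x)]
    ring
  have hh := hOutC1_nonneg k Adj σ hπ
  set h := hOutC1 k Adj σ π
  set a := √(1 + 1 / 2 * h) - 1 with ha
  have ha0 : 0 ≤ a := by
    rw [ha, sub_nonneg]
    exact Real.one_le_sqrt.mpr (by linarith)
  have hah : h = 2 * a ^ 2 + 4 * a := by
    have := Real.sq_sqrt (show 0 ≤ 1 + 1 / 2 * h by linarith)
    rw [show √(1 + 1 / 2 * h) = a + 1 by rw [ha]; ring] at this
    linarith
  have hs2 := Real.sq_sqrt hS0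
  have hr2 := Real.sq_sqrt hR0
  have hs0 := Real.sqrt_nonneg S
  have hr0 := Real.sqrt_nonneg R
  have hle : (a * √S + √S) ^ 2 ≤ (√S + √R) ^ 2 := by
    have e : (a * √S + √S) ^ 2 = (h / 2 + 1) * √S ^ 2 := by rw [hah]; ring
    rw [e, add_sq, hs2, hr2]
    linarith
  have hlin : a * √S ≤ √R := by
    have := abs_le_of_sq_le_sq hle (by positivity)
    linarith [le_abs_self (a * √S + √S)]
  calc a ^ 2 * S = (a * √S) ^ 2 := by rw [mul_pow, hs2]
    _ ≤ √R ^ 2 := by gcongr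
    _ = R := hr2
end
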